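/- arXiv:2107.03495 — 2 statements merged into one kernel-verified Lean document; each statement's English description precedes it below -/
import Mathlib

section
/- Existence and structure of minimizers of the penalized base energy: Let n ≥ 2, R > 0 and 0 < v < v_max < |B_R(0)|. There exists η₀ > 0 depending only on n, R, v, v_max such that for every η ≤ η₀ there exists 𝔗₀ > 0 (depending additionally on η) such that for every 𝔗 ≤ 𝔗₀: ℰ_min > −∞, the infimum ℰ_min = inf{ ℰ(Ω) : Ω ∈ 𝓗 } is attained by some open set Ω ∈ 𝓗, and moreover every minimizer is connected and satisfies |Ω| = v. -/
open MeasureTheory Metric Set Filter Bornology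
open scoped ENNReal NNReal Topology

noncomputable section

abbrev Euc (n : ℕ) := EuclideanSpace ℝ (Fin n)

/-- A smooth test function compactly supported in `Ω`. -/
def IsTestFun {n : ℕ} (Ω : Set (Euc n)) (φ : Euc n → ℝ) : Prop :=
  ContDiff ℝ (⊤ : ℕ∞) φ ∧ HasCompactSupport φ ∧ tsupport φ ⊆ Ω

/-- `u` belongs to `H¹₀(Ω)` with weak gradient `Du`: it is an `L²` limit of smooth
functions compactly supported in `Ω` whose gradients converge to `Du` in `L²`. -/
def MemH10 {n : ℕ} (Ω : Set (Euc n)) (u : Euc n → ℝ) (Du : Euc n → Euc n) : Prop :=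
  MemLp u 2 volume ∧ MemLp Du 2 volume ∧
  ∃ φ : ℕ → Euc n → ℝ, (∀ k, IsTestFun Ω (φ k)) ∧
    Tendsto (fun k => ∫ x, (φ k x - u x) ^ 2) atTop (𝓝 0) ∧
    Tendsto (fun k => ∫ x, ‖gradient (φ k) x - Du x‖ ^ 2) atTop (𝓝 0)

/-- First Dirichlet eigenvalue: infimum of the Rayleigh quotient over `H¹₀(Ω)`. -/
def lam1 {n : ℕ} (Ω : Set (Euc n)) : ℝ :=
  sInf {r | ∃ u Du, MemH10 Ω u Du ∧ (∫ x, u x ^ 2) ≠ 0 ∧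
    r = (∫ x, ‖Du x‖ ^ 2) / (∫ x, u x ^ 2)}

/-- Torsional rigidity: `tor Ω = inf { ∫ (½|∇w|² − w) : w ∈ H¹₀(Ω) }`. -/
def tor {n : ℕ} (Ω : Set (Euc n)) : ℝ :=
  sInf {r | ∃ w Dw, MemH10 Ω w Dw ∧ r = ∫ x, ((1 / 2) * ‖Dw x‖ ^ 2 - w x)}

/-- Normalized first eigenfunction of `Ω`, extended by zero outside `Ω`. -/
def IsEigenfun {n : ℕ} (Ω : Set (Euc n)) (u : Euc n → ℝ) : Prop :=
  (∀ᵐ x ∂volume, 0 ≤ u x) ∧ (∀ x ∉ Ω, u x = 0) ∧ (∫ x, u x ^ 2) = 1 ∧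
  ∃ Du, MemH10 Ω u Du ∧ (∫ x, ‖Du x‖ ^ 2) = lam1 Ω

/-- The torsion function of `Ω` (the minimizer of the torsion energy),
extended by zero outside `Ω`. -/
def IsTorsionFun {n : ℕ} (Ω : Set (Euc n)) (w : Euc n → ℝ) : Prop :=
  (∀ x ∉ Ω, w x = 0) ∧
  ∃ Dw, MemH10 Ω w Dw ∧ (∫ x, ((1 / 2) * ‖Dw x‖ ^ 2 - w x)) = tor Ω

/-- The volume penalization `f_{v,η}`. -/
def fpen (v η t : ℝ) : ℝ := if t ≤ v then η * (t - v) else (t - v) / η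

/-- The base energy `ℰ(Ω) = λ₁(Ω) + 𝔗·tor(Ω) + f_{v,η}(|Ω|)`. -/
def baseE {n : ℕ} (v η 𝔗 : ℝ) (Ω : Set (Euc n)) : ℝ :=
  lam1 Ω + 𝔗 * tor Ω + fpen v η (volume Ω).toReal

/-- The admissible class `𝓗 = { Ω ⊆ B_R(0) open nonempty : |Ω| ≤ v_max }`. -/
def Hclass (n : ℕ) (R vmax : ℝ) : Set (Set (Euc n)) :=
  {Ω | IsOpen Ω ∧ Ω.Nonempty ∧ Ω ⊆ ball (0 : Euc n) R ∧ (volume Ω).toReal ≤ vmax}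

/-- `ℰ_min = inf { ℰ(Ω) : Ω ∈ 𝓗 }`. -/
def Emin (n : ℕ) (R vmax v η 𝔗 : ℝ) : ℝ :=
  sInf (baseE v η 𝔗 '' Hclass n R vmax)

/-- `u` is the (a.e.-) unique normalized first eigenfunction of `Ω`. -/
def UniqueEigen {n : ℕ} (Ω : Set (Euc n)) (u : Euc n → ℝ) : Prop :=
  IsEigenfun Ω u ∧ ∀ u' : Euc n → ℝ, IsEigenfun Ω u' → u' =ᵐ[volume] u

/-- An admissible nonlinearity with threshold `τ₀`: `𝔥 : 𝓗 → [0,1]` which is Lipschitz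
with respect to the symmetric difference plus the `L¹` eigenfunction distance, on sets
of nearly minimal base energy possessing a unique normalized first eigenfunction. -/
def Admissible (n : ℕ) (R vmax v η 𝔗 τ₀ : ℝ) (h : Set (Euc n) → ℝ) : Prop :=
  (∀ Ω ∈ Hclass n R vmax, h Ω ∈ Icc (0 : ℝ) 1) ∧
  ∀ Ω ∈ Hclass n R vmax, ∀ Ω' ∈ Hclass n R vmax,
    baseE v η 𝔗 Ω ≤ Emin n R vmax v η 𝔗 + τ₀ →
    baseE v η 𝔗 Ω' ≤ Emin n R vmax v η 𝔗 + τ₀ →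
    ∀ u u' : Euc n → ℝ, UniqueEigen Ω u → UniqueEigen Ω' u' →
      |h Ω - h Ω'| ≤ (volume (symmDiff Ω Ω')).toReal + ∫ x, |u x - u' x|

/-- The main energy `ℱ_τ(Ω) = ℰ(Ω) + τ·𝔥(Ω)`. -/
def mainE {n : ℕ} (v η 𝔗 τ : ℝ) (h : Set (Euc n) → ℝ) (Ω : Set (Euc n)) : ℝ :=
  baseE v η 𝔗 Ω + τ * h Ω

section BM
open scoped Pointwise

lemma bm1_compact {K L C : Set ℝ} (hK : IsCompact K) (hL : IsCompact L) (hKn : K.Nonempty)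
    (hLn : L.Nonempty) (h : ∀ a ∈ K, ∀ b ∈ L, a + b ∈ C) : volume K + volume L ≤ volume C := by
  obtain ⟨k, hk, hk'⟩ := hK.exists_isGreatest hKn
  obtain ⟨l, hl, hl'⟩ := hL.exists_isLeast hLn
  have h1 : volume K = volume ((fun x => x + l) '' K) := by
    rw [image_add_right, measure_preimage_add_right]
  have h2 : volume L = volume ((fun x => k + x) '' L) := by
    rw [image_add_left, measure_preimage_add]
  rw [h1, h2, ← measure_union₀]
  · apply measure_mono
    rintro x (⟨y, hy, rfl⟩ | ⟨y, hy, rfl⟩)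
    · exact h _ hy _ hl
    · exact h _ hk _ hy
  · exact (hL.image (by fun_prop)).measurableSet.nullMeasurableSet
  · have : ((fun x => x + l) '' K) ∩ ((fun x => k + x) '' L) ⊆ {k + l} := by
      rintro x ⟨⟨y, hy, rfl⟩, ⟨z, hz, hzy⟩⟩
      have := hk' hy
      have := hl' hz
      simp only [mem_singleton_iff] at *
      linarith
    exact measure_mono_null this (by simp)

lemma bm1 {A B C : Set ℝ} (hA : MeasurableSet A) (hB : MeasurableSet B) (hAn : A.Nonempty)
    (hBn : B.Nonempty) (h : ∀ a ∈ A, ∀ b ∈ B, a + b ∈ C) : volume A + volume B ≤ volume C := by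
  obtain ⟨a, ha⟩ := hAn
  obtain ⟨b, hb⟩ := hBn
  have key : ∀ K, (K ⊆ A ∧ IsCompact K) → ∀ L, (L ⊆ B ∧ IsCompact L) →
      volume K + volume L ≤ volume C := by
    intro K hK L hL
    calc volume K + volume L ≤ volume (insert a K) + volume (insert b L) := by
          gcongr <;> exact subset_insert _ _
      _ ≤ volume C := by
          refine bm1_compact (hK.2.insert a) (hL.2.insert b) ⟨a, mem_insert _ _⟩
            ⟨b, mem_insert _ _⟩ ?_
          intro x hx y hy
          exact h x (insert_subset ha hK.1 hx) y (insert_subset hb hL.1 hy)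
  rw [hA.measure_eq_iSup_isCompact, hB.measure_eq_iSup_isCompact]
  simp_rw [iSup_and']
  exact ENNReal.biSup_add_biSup_le' ⟨∅, by simp⟩ ⟨∅, by simp⟩ key

lemma amgm_ennreal {p q : ℝ} (hp : 0 < p) (hq : 0 < q) (hpq : p + q = 1) (a b : ℝ≥0∞) :
    a ^ p * b ^ q ≤ ENNReal.ofReal p * a + ENNReal.ofReal q * b := by
  have hp' : ENNReal.ofReal p ≠ 0 := by simpa using hp
  have hq' : ENNReal.ofReal q ≠ 0 := by simpa using hq
  by_cases ha : a = ⊤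
  · subst ha; simp [ENNReal.mul_top hp']
  by_cases hb : b = ⊤
  · subst hb; simp [ENNReal.mul_top hq']
  lift a to ℝ≥0 using ha
  lift b to ℝ≥0 using hb
  have := NNReal.geom_mean_le_arith_mean2_weighted ⟨p, hp.le⟩ ⟨q, hq.le⟩ a b
    (NNReal.eq hpq)
  rw [← ENNReal.coe_rpow_of_nonneg _ hp.le, ← ENNReal.coe_rpow_of_nonneg _ hq.le,
    ENNReal.ofReal_eq_coe_nnreal hp.le, ENNReal.ofReal_eq_coe_nnreal hq.le]
  exact_mod_cast this

lemma pl1_norm {p q : ℝ} (hp : 0 < p) (hq : 0 < q) (hpq : p + q = 1) {f g h : ℝ → ℝ}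
    (hf : Measurable f) (hg : Measurable g) (hh : Measurable h)
    (hf0 : ∀ x, 0 ≤ f x) (hg0 : ∀ x, 0 ≤ g x) (hf1 : ∀ x, f x ≤ 1) (hg1 : ∀ x, g x ≤ 1)
    (hh0 : ∀ x, 0 ≤ h x)
    (hfs : ∀ t < 1, ∃ x, t < f x) (hgs : ∀ t < 1, ∃ x, t < g x)
    (H : ∀ x y, f x ^ p * g y ^ q ≤ h (p * x + q * y)) :
    ENNReal.ofReal p * (∫⁻ x, ENNReal.ofReal (f x)) + ENNReal.ofReal q * (∫⁻ x, ENNReal.ofReal (g x))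
      ≤ ∫⁻ x, ENNReal.ofReal (h x) := by
  rw [lintegral_eq_lintegral_meas_lt _ (ae_of_all _ hf0) hf.aemeasurable,
    lintegral_eq_lintegral_meas_lt _ (ae_of_all _ hg0) hg.aemeasurable,
    lintegral_eq_lintegral_meas_lt _ (ae_of_all _ hh0) hh.aemeasurable]
  have mf : Measurable fun t => volume {a | t < f a} := by
    apply Antitone.measurable
    intro s t hst
    exact measure_mono fun x hx => lt_of_le_of_lt hst hx
  have mg : Measurable fun t => volume {a | t < g a} := by
    apply Antitone.measurable
    intro s t hst
    exact measure_mono fun x hx => lt_of_le_of_lt hst hx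
  rw [← lintegral_const_mul _ mf, ← lintegral_const_mul _ mg,
    ← lintegral_add_left (by fun_prop)]
  apply setLIntegral_mono' measurableSet_Ioi
  intro t ht
  have ht : 0 < t := ht
  by_cases ht1 : t < 1
  · have e1 : ENNReal.ofReal p * volume {a | t < f a} = volume (p • {a | t < f a}) := by
      rw [Measure.addHaar_smul]; simp [abs_of_pos hp]
    have e2 : ENNReal.ofReal q * volume {a | t < g a} = volume (q • {a | t < g a}) := by
      rw [Measure.addHaar_smul]; simp [abs_of_pos hq]
    rw [e1, e2]
    apply bm1
    · exact (measurableSet_lt measurable_const hf).const_smul₀ p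
    · exact (measurableSet_lt measurable_const hg).const_smul₀ q
    · exact (show ({a | t < f a} : Set ℝ).Nonempty from hfs t ht1).smul_set
    · exact (show ({a | t < g a} : Set ℝ).Nonempty from hgs t ht1).smul_set
    · rintro _ ⟨x, hx, rfl⟩ _ ⟨y, hy, rfl⟩
      have hx : t < f x := hx
      have hy : t < g y := hy
      refine lt_of_lt_of_le ?_ (H x y)
      calc t = t ^ p * t ^ q := by rw [← Real.rpow_add ht, hpq, Real.rpow_one]
        _ < f x ^ p * g y ^ q := by
          apply mul_lt_mul'' (Real.rpow_lt_rpow ht.le hx hp) (Real.rpow_lt_rpow ht.le hy hq) <;>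
            positivity
  · have e1 : {a | t < f a} = ∅ := by
      ext x; simpa using (hf1 x).trans (not_lt.mp ht1)
    have e2 : {a | t < g a} = ∅ := by
      ext x; simpa using (hg1 x).trans (not_lt.mp ht1)
    simp [e1, e2]

lemma pl1_bdd {p q : ℝ} (hp : 0 < p) (hq : 0 < q) (hpq : p + q = 1) {f g h : ℝ → ℝ≥0∞}
    (hf : Measurable f) (hg : Measurable g) (hh : Measurable h)
    {N : ℝ≥0∞} (hN : N ≠ ⊤) (hfN : ∀ x, f x ≤ N) (hgN : ∀ x, g x ≤ N)
    (H : ∀ x y, f x ^ p * g y ^ q ≤ h (p * x + q * y)) :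
    (∫⁻ x, f x) ^ p * (∫⁻ x, g x) ^ q ≤ ∫⁻ x, h x := by
  set α := ⨆ x, f x with hα
  set β := ⨆ x, g x with hβ
  have hfα : ∀ x, f x ≤ α := fun x => le_iSup f x
  have hgβ : ∀ x, g x ≤ β := fun x => le_iSup g x
  have hα1 : α ≠ ⊤ := ne_top_of_le_ne_top hN (iSup_le hfN)
  have hβ1 : β ≠ ⊤ := ne_top_of_le_ne_top hN (iSup_le hgN)
  by_cases hα0 : α = 0
  · have : ∀ x, f x = 0 := fun x => le_antisymm (hα0 ▸ hfα x) zero_le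
    simp [this, ENNReal.zero_rpow_of_pos hp]
  by_cases hβ0 : β = 0
  · have : ∀ x, g x = 0 := fun x => le_antisymm (hβ0 ▸ hgβ x) zero_le
    simp [this, ENNReal.zero_rpow_of_pos hq]
  set c := α ^ p * β ^ q with hc
  have hc0 : c ≠ 0 := by
    simp [hc, ENNReal.rpow_eq_zero_iff, hα0, hβ0, hα1, hβ1]
  have hc1 : c ≠ ⊤ := ENNReal.mul_ne_top (ENNReal.rpow_ne_top_of_nonneg hp.le hα1)
    (ENNReal.rpow_ne_top_of_nonneg hq.le hβ1)
  have hfa : ∀ x, f x / α ≤ 1 := fun x => ENNReal.div_le_of_le_mul (by simpa using hfα x)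
  have hgb : ∀ x, g x / β ≤ 1 := fun x => ENNReal.div_le_of_le_mul (by simpa using hgβ x)
  have hfa' : ∀ x, f x / α ≠ ⊤ := fun x => ne_top_of_le_ne_top ENNReal.one_ne_top (hfa x)
  have hgb' : ∀ x, g x / β ≠ ⊤ := fun x => ne_top_of_le_ne_top ENNReal.one_ne_top (hgb x)
  have hmin : ∀ x, min (h x / c) 1 ≠ ⊤ := fun x =>
    ne_top_of_le_ne_top ENNReal.one_ne_top (min_le_right _ _)
  have sup_aux : ∀ (F : ℝ → ℝ≥0∞) (γ : ℝ≥0∞), γ = (⨆ x, F x) → γ ≠ 0 → γ ≠ ⊤ →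
      (∀ x, F x / γ ≠ ⊤) → ∀ t : ℝ, t < 1 → ∃ x, t < (F x / γ).toReal := by
    intro F γ hγ h0 h1 hF t ht
    have : γ * ENNReal.ofReal t < γ := by
      calc γ * ENNReal.ofReal t < γ * 1 := by
            apply ENNReal.mul_lt_mul_right h0 h1
            simpa using ht
        _ = γ := mul_one _
    conv_rhs at this => rw [hγ]
    obtain ⟨x, hx⟩ := lt_iSup_iff.1 this
    refine ⟨x, ?_⟩
    have h2 : ENNReal.ofReal t < F x / γ := by
      rw [ENNReal.lt_div_iff_mul_lt (Or.inl h0) (Or.inl h1), mul_comm]; exact hx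
    have h3 := (ENNReal.toReal_lt_toReal ENNReal.ofReal_ne_top (hF x)).2 h2
    rw [ENNReal.toReal_ofReal'] at h3
    exact lt_of_le_of_lt (le_max_left _ _) h3
  have key := pl1_norm hp hq hpq (f := fun x => (f x / α).toReal) (g := fun x => (g x / β).toReal)
    (h := fun x => (min (h x / c) 1).toReal) (by fun_prop) (by fun_prop) (by fun_prop)
    (fun x => ENNReal.toReal_nonneg) (fun x => ENNReal.toReal_nonneg)
    (fun x => ENNReal.toReal_le_of_le_ofReal zero_le_one (by simpa using hfa x))
    (fun x => ENNReal.toReal_le_of_le_ofReal zero_le_one (by simpa using hgb x))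
    (fun x => ENNReal.toReal_nonneg)
    (sup_aux f α hα hα0 hα1 hfa') (sup_aux g β hβ hβ0 hβ1 hgb') ?_
  · simp_rw [ENNReal.ofReal_toReal (hfa' _), ENNReal.ofReal_toReal (hgb' _),
      ENNReal.ofReal_toReal (hmin _)] at key
    have k2 := (amgm_ennreal hp hq hpq (∫⁻ x, f x / α) (∫⁻ x, g x / β)).trans key
    have k3 : ∫⁻ x, min (h x / c) 1 ≤ ∫⁻ x, h x / c := lintegral_mono fun x => min_le_left _ _
    have k4 := k2.trans k3
    simp_rw [div_eq_mul_inv] at k4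
    rw [lintegral_mul_const _ hf, lintegral_mul_const _ hg, lintegral_mul_const _ hh,
      ENNReal.mul_rpow_of_nonneg _ _ hp.le, ENNReal.mul_rpow_of_nonneg _ _ hq.le,
      ENNReal.inv_rpow, ENNReal.inv_rpow] at k4
    have k5 : (∫⁻ x, f x) ^ p * (∫⁻ x, g x) ^ q * c⁻¹ ≤ (∫⁻ x, h x) * c⁻¹ := by
      rw [hc, ENNReal.mul_inv (Or.inr (ENNReal.rpow_ne_top_of_nonneg hq.le hβ1))
        (Or.inl (ENNReal.rpow_ne_top_of_nonneg hp.le hα1))]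
      refine le_trans (le_of_eq ?_) (k4.trans (le_of_eq ?_))
      · ring
      · rw [hc, ENNReal.mul_inv (Or.inr (ENNReal.rpow_ne_top_of_nonneg hq.le hβ1))
          (Or.inl (ENNReal.rpow_ne_top_of_nonneg hp.le hα1))]
    exact (ENNReal.mul_le_mul_iff_left (ENNReal.inv_ne_zero.2 hc1) (ENNReal.inv_ne_top.2 hc0)).1 k5
  · intro x y
    rw [ENNReal.toReal_rpow, ENNReal.toReal_rpow, ← ENNReal.toReal_mul]
    apply ENNReal.toReal_mono (hmin _)
    apply le_min
    · rw [ENNReal.div_rpow_of_nonneg _ _ hp.le, ENNReal.div_rpow_of_nonneg _ _ hq.le]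
      rw [ENNReal.le_div_iff_mul_le (Or.inl hc0) (Or.inl hc1)]
      refine le_trans (le_of_eq ?_) (H x y)
      have a1 : α ^ p ≠ 0 := by simp [ENNReal.rpow_eq_zero_iff, hα0, hα1]
      have a2 : α ^ p ≠ ⊤ := ENNReal.rpow_ne_top_of_nonneg hp.le hα1
      have b1 : β ^ q ≠ 0 := by simp [ENNReal.rpow_eq_zero_iff, hβ0, hβ1]
      have b2 : β ^ q ≠ ⊤ := ENNReal.rpow_ne_top_of_nonneg hq.le hβ1
      rw [hc, mul_mul_mul_comm, ENNReal.div_mul_cancel a1 a2, ENNReal.div_mul_cancel b1 b2]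
    · exact mul_le_one' (ENNReal.rpow_le_one (hfa x) hp.le) (ENNReal.rpow_le_one (hgb y) hq.le)

lemma pl1 {p q : ℝ} (hp : 0 < p) (hq : 0 < q) (hpq : p + q = 1) {f g h : ℝ → ℝ≥0∞}
    (hf : Measurable f) (hg : Measurable g) (hh : Measurable h)
    (H : ∀ x y, f x ^ p * g y ^ q ≤ h (p * x + q * y)) :
    (∫⁻ x, f x) ^ p * (∫⁻ x, g x) ^ q ≤ ∫⁻ x, h x := by
  by_cases h0 : ∫⁻ x, f x = 0
  · simp [h0, ENNReal.zero_rpow_of_pos hp]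
  by_cases h1 : ∫⁻ x, g x = 0
  · simp [h1, ENNReal.zero_rpow_of_pos hq]
  have key : ∀ F : ℝ → ℝ≥0∞, Measurable F →
      Tendsto (fun N : ℕ => ∫⁻ x, min (F x) N) atTop (𝓝 (∫⁻ x, F x)) := by
    intro F hF
    apply lintegral_tendsto_of_tendsto_of_monotone
    · intro N; fun_prop
    · refine ae_of_all _ fun x N M hNM => ?_
      simp only
      gcongr
    · refine ae_of_all _ fun x => ?_
      have : Tendsto (fun N : ℕ => min (F x) (N : ℝ≥0∞)) atTop (𝓝 (min (F x) ⊤)) :=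
        tendsto_const_nhds.min ENNReal.tendsto_nat_nhds_top
      simpa using this
  have t1 := (key f hf).ennrpow_const p
  have t2 := (key g hg).ennrpow_const q
  refine le_of_tendsto (ENNReal.Tendsto.mul t1 (Or.inl ?_) t2 (Or.inl ?_)) ?_
  · simp [ENNReal.rpow_eq_zero_iff, h0, not_lt.2 hp.le]
  · simp [ENNReal.rpow_eq_zero_iff, h1, not_lt.2 hq.le]
  · refine Eventually.of_forall fun N => ?_
    refine pl1_bdd hp hq hpq (by fun_prop) (by fun_prop) hh (ENNReal.natCast_ne_top N)
      (fun x => min_le_right _ _) (fun x => min_le_right _ _) fun x y => le_trans ?_ (H x y)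
    gcongr <;> exact min_le_left _ _

lemma pl_pi {p q : ℝ} (hp : 0 < p) (hq : 0 < q) (hpq : p + q = 1) (n : ℕ) :
    ∀ {f g h : (Fin n → ℝ) → ℝ≥0∞},
    Measurable f → Measurable g → Measurable h →
    (∀ x y, f x ^ p * g y ^ q ≤ h (p • x + q • y)) →
    (∫⁻ x, f x) ^ p * (∫⁻ x, g x) ^ q ≤ ∫⁻ x, h x := by
  induction n with
  | zero =>
    intro f g h hf hg hh H
    have : ∀ F : (Fin 0 → ℝ) → ℝ≥0∞, ∫⁻ x, F x = F 0 := by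
      intro F
      rw [lintegral_unique]
      rw [volume_pi, Measure.pi_of_empty]
      simp only [measure_univ, mul_one]
      congr 1
      exact Subsingleton.elim _ _
    rw [this, this, this]
    simpa using H 0 0
  | succ n ih =>
    intro f g h hf hg hh H
    let e := (MeasurableEquiv.piFinSuccAbove (fun _ : Fin (n+1) => ℝ) 0).symm
    have he : MeasurePreserving e :=
      (volume_preserving_piFinSuccAbove (fun _ : Fin (n+1) => ℝ) 0).symm
    have conv : ∀ F : (Fin (n+1) → ℝ) → ℝ≥0∞, Measurable F →
        ∫⁻ x, F x = ∫⁻ a : ℝ, ∫⁻ y : Fin n → ℝ, F (e (a, y)) := by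
      intro F hF
      rw [← he.lintegral_comp hF]
      exact lintegral_prod _ (hF.comp e.measurable).aemeasurable
    rw [conv f hf, conv g hg, conv h hh]
    have hm : ∀ F : (Fin (n+1) → ℝ) → ℝ≥0∞, Measurable F →
        Measurable fun a : ℝ => ∫⁻ y : Fin n → ℝ, F (e (a, y)) := fun F hF =>
      Measurable.lintegral_prod_right' (f := fun z => F (e z)) (hF.comp e.measurable)
    have hm' : ∀ F : (Fin (n+1) → ℝ) → ℝ≥0∞, Measurable F → ∀ a : ℝ,
        Measurable fun y : Fin n → ℝ => F (e (a, y)) := fun F hF a =>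
      (hF.comp e.measurable).comp measurable_prodMk_left
    refine pl1 hp hq hpq (hm f hf) (hm g hg) (hm h hh) fun a b => ?_
    refine ih (hm' f hf a) (hm' g hg b) (hm' h hh _) fun x y => ?_
    refine (H _ _).trans (le_of_eq ?_)
    congr 1
    ext i
    refine Fin.cases ?_ (fun j => ?_) i <;> simp [e, MeasurableEquiv.piFinSuccAbove]

/-- Brunn-Minkowski for a ball. -/
lemma bm_ball {n : ℕ} (hn : 2 ≤ n) {A : Set (Euc n)} (hA : IsOpen A) {r s : ℝ} (hr : 0 < r)
    (hs : 0 < s) (hAr : volume (ball (0 : Euc n) r) ≤ volume A) :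
    volume (ball (0 : Euc n) (r + s)) ≤ volume (thickening s A) := by
  have hnt : Nontrivial (Euc n) := by
    have : Nonempty (Fin n) := ⟨⟨0, by omega⟩⟩
    infer_instance
  set p := r / (r + s) with hp
  set q := s / (r + s) with hq
  have hp0 : 0 < p := by positivity
  have hq0 : 0 < q := by positivity
  have hpq : p + q = 1 := by rw [hp, hq]; field_simp
  set V := volume (ball (0 : Euc n) (r + s)) with hV
  set A' : Set (Euc n) := p⁻¹ • A with hA'
  have hA'V : V ≤ volume A' := by
    rw [hA', Measure.addHaar_smul_of_nonneg _ (by positivity)]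
    have : V = ENNReal.ofReal (p⁻¹ ^ Module.finrank ℝ (Euc n)) * volume (ball (0 : Euc n) r) := by
      rw [hV, ← Measure.addHaar_ball_mul_of_pos _ _ (by positivity)]
      congr 2
      rw [hp]; field_simp
    rw [this]
    gcongr
  have hA'o : IsOpen A' := hA.smul₀ (by positivity)
  have hV0 : V ≠ ⊤ := measure_ball_lt_top.ne
  have hVpos : V ≠ 0 := (measure_ball_pos _ _ (by positivity)).ne'
  have me := (PiLp.volume_preserving_toLp (Fin n))
  have mm : ∀ S : Set (Euc n), MeasurableSet S →
      ∫⁻ x : Fin n → ℝ, S.indicator (1 : Euc n → ℝ≥0∞) (WithLp.toLp 2 x) = volume S := by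
    intro S hS
    rw [me.lintegral_comp (measurable_one.indicator hS), lintegral_indicator_one hS]
  have key := pl_pi hp0 hq0 hpq n
    (f := fun x => A'.indicator (1 : Euc n → ℝ≥0∞) (WithLp.toLp 2 x))
    (g := fun x => (ball (0 : Euc n) (r + s)).indicator (1 : Euc n → ℝ≥0∞) (WithLp.toLp 2 x))
    (h := fun x => (thickening s A).indicator (1 : Euc n → ℝ≥0∞) (WithLp.toLp 2 x))
    ((measurable_one.indicator hA'o.measurableSet).comp me.measurable)
    ((measurable_one.indicator isOpen_ball.measurableSet).comp me.measurable)
    ((measurable_one.indicator isOpen_thickening.measurableSet).comp me.measurable) ?_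
  · rw [mm _ hA'o.measurableSet, mm _ isOpen_ball.measurableSet,
      mm _ isOpen_thickening.measurableSet] at key
    refine le_trans ?_ key
    calc V = V ^ p * V ^ q := by rw [← ENNReal.rpow_add _ _ hVpos hV0, hpq, ENNReal.rpow_one]
      _ ≤ _ := by gcongr
  · intro x y
    by_cases hx : WithLp.toLp 2 x ∈ A'
    · by_cases hy : WithLp.toLp 2 y ∈ ball (0 : Euc n) (r + s)
      · have : WithLp.toLp 2 (p • x + q • y) ∈ thickening s A := by
          obtain ⟨a, ha, hax⟩ := hx
          rw [mem_thickening_iff]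
          refine ⟨a, ha, ?_⟩
          have e1 : p • WithLp.toLp 2 x = a := by
            rw [← hax]; simp only [smul_smul]; rw [mul_inv_cancel₀ hp0.ne', one_smul]
          rw [WithLp.toLp_add, WithLp.toLp_smul, WithLp.toLp_smul, e1, dist_eq_norm]
          simp only [add_sub_cancel_left, norm_smul, Real.norm_eq_abs, abs_of_pos hq0]
          rw [mem_ball_zero_iff] at hy
          calc q * ‖WithLp.toLp 2 y‖ < q * (r + s) := by gcongr
            _ = s := by rw [hq]; field_simp
        rw [indicator_of_mem hx, indicator_of_mem hy, indicator_of_mem this]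
        simp
      · simp only [indicator_of_notMem hy, ENNReal.zero_rpow_of_pos hq0, mul_zero]; exact zero_le
    · simp only [indicator_of_notMem hx, ENNReal.zero_rpow_of_pos hp0, zero_mul]; exact zero_le

end BM

/-- Supremum over the ball of radius `s`. -/
def supS {n : ℕ} (s : ℝ) (f : Euc n → ℝ) (x : Euc n) : ℝ := ⨆ y : ball x s, f y

lemma bdd_supS {n : ℕ} {M : ℝ} {f : Euc n → ℝ} (hM : ∀ x, f x ≤ M) (s : ℝ) (x : Euc n) :
    BddAbove (range fun y : ball x s => f y) := by
  refine ⟨M, ?_⟩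
  rintro _ ⟨y, rfl⟩
  exact hM y

lemma le_supS {n : ℕ} {M : ℝ} {f : Euc n → ℝ} (hM : ∀ x, f x ≤ M) {s : ℝ} {x y : Euc n}
    (hy : dist y x < s) : f y ≤ supS s f x :=
  le_ciSup (bdd_supS hM s x) ⟨y, hy⟩

lemma supS_le {n : ℕ} {M : ℝ} {f : Euc n → ℝ} {s : ℝ} (hs : 0 < s) {x : Euc n}
    (hM : ∀ y, dist y x < s → f y ≤ M) : supS s f x ≤ M := by
  have : Nonempty (ball x s) := ⟨⟨x, mem_ball_self hs⟩⟩
  exact ciSup_le fun y => hM y y.2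

lemma lt_supS {n : ℕ} {M : ℝ} {f : Euc n → ℝ} (hM : ∀ x, f x ≤ M) {s : ℝ} (hs : 0 < s) (t : ℝ) :
    {x | t < supS s f x} = thickening s {x | t < f x} := by
  ext x
  have : Nonempty (ball x s) := ⟨⟨x, mem_ball_self hs⟩⟩
  rw [mem_thickening_iff]
  simp only [mem_ofPred_eq, supS]
  rw [lt_ciSup_iff (bdd_supS hM s x)]
  constructor
  · rintro ⟨y, hy⟩; exact ⟨y, hy, by rw [dist_comm]; exact y.2⟩
  · rintro ⟨y, hy, h⟩; exact ⟨⟨y, by rw [mem_ball, dist_comm]; exact h⟩, hy⟩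

lemma measurable_supS {n : ℕ} {M : ℝ} {f : Euc n → ℝ} (hM : ∀ x, f x ≤ M) {s : ℝ} (hs : 0 < s) :
    Measurable (supS s f) := by
  apply measurable_of_Ioi
  intro t
  have : supS s f ⁻¹' Ioi t = {x | t < supS s f x} := rfl
  rw [this, lt_supS hM hs]
  exact isOpen_thickening.measurableSet

lemma nontriv {n : ℕ} (hn : 2 ≤ n) : Nontrivial (Euc n) := by
  have : Nonempty (Fin n) := ⟨⟨0, by omega⟩⟩
  infer_instance

lemma vol_ball {n : ℕ} (hn : 2 ≤ n) {r : ℝ} (hr : 0 ≤ r) :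
    volume (ball (0 : Euc n) r) = ENNReal.ofReal (r ^ n) * volume (ball (0 : Euc n) 1) := by
  have := nontriv hn
  rw [Measure.addHaar_ball _ _ hr]; simp

lemma vol_ball_lt {n : ℕ} (hn : 2 ≤ n) {a b : ℝ} (ha : 0 ≤ a) (hb : 0 ≤ b) :
    volume (ball (0 : Euc n) a) < volume (ball (0 : Euc n) b) ↔ a < b := by
  constructor
  · intro h
    by_contra hab
    exact absurd h (not_lt.2 (measure_mono (ball_subset_ball (not_lt.1 hab))))
  · intro h
    rw [vol_ball hn ha, vol_ball hn hb]
    apply ENNReal.mul_lt_mul_left (measure_ball_pos _ _ one_pos).ne' measure_ball_lt_top.ne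
    rw [ENNReal.ofReal_lt_ofReal_iff (pow_pos (lt_of_le_of_lt ha h) n)]
    exact pow_lt_pow_left₀ h ha (by omega)

lemma exists_radius {n : ℕ} (hn : 2 ≤ n) {m : ℝ≥0∞} (hm : m ≠ ⊤) :
    ∃ r : ℝ, 0 ≤ r ∧ volume (ball (0 : Euc n) r) = m := by
  set ω := volume (ball (0 : Euc n) 1) with hω
  have h0 : ω ≠ 0 := (measure_ball_pos _ _ one_pos).ne'
  have h1 : ω ≠ ⊤ := measure_ball_lt_top.ne
  refine ⟨(m / ω).toReal ^ ((n : ℝ)⁻¹), by positivity, ?_⟩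
  rw [vol_ball hn (by positivity), Real.rpow_inv_natCast_pow (by positivity) (by omega),
    ENNReal.ofReal_toReal (ENNReal.div_ne_top hm h0), ENNReal.div_mul_cancel h0 h1]

/-- Symmetric decreasing rearrangement. -/
def rearr {n : ℕ} (u : Euc n → ℝ) (x : Euc n) : ℝ :=
  sSup {t : ℝ | volume (ball (0 : Euc n) ‖x‖) < volume {y | t < u y}}

lemma lt_rearr {n : ℕ} {M : ℝ} {u : Euc n → ℝ} (h0 : ∀ x, 0 ≤ u x) (hM : ∀ x, u x ≤ M)
    (hn : 2 ≤ n) (t : ℝ) (x : Euc n) :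
    t < rearr u x ↔ volume (ball (0 : Euc n) ‖x‖) < volume {y | t < u y} := by
  have := nontriv hn
  set S := {t : ℝ | volume (ball (0 : Euc n) ‖x‖) < volume {y | t < u y}} with hS
  have hbdd : BddAbove S := by
    refine ⟨M, fun s hs => ?_⟩
    by_contra hMs
    have : {y | s < u y} = ∅ := by
      ext y; simpa using (hM y).trans (not_le.1 hMs).le
    simp [hS, this] at hs
  have hne : S.Nonempty := by
    refine ⟨-1, ?_⟩
    have : {y | -1 < u y} = univ := by
      ext y; simpa using lt_of_lt_of_le (by norm_num) (h0 y)
    simp only [hS, mem_ofPred_eq, this]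
    rw [measure_univ_of_isAddLeftInvariant]
    exact measure_ball_lt_top
  constructor
  · intro h
    obtain ⟨s, hs, hts⟩ := exists_lt_of_lt_csSup hne h
    exact lt_of_lt_of_le hs (measure_mono fun y hy => hts.trans hy)
  · intro h
    have e : {y | t < u y} = ⋃ k : ℕ, {y | t + 1 / ((k : ℝ) + 1) < u y} := by
      ext y
      simp only [mem_ofPred_eq, mem_iUnion]
      constructor
      · intro hy
        obtain ⟨k, hk⟩ := exists_nat_one_div_lt (sub_pos.2 hy)
        exact ⟨k, by linarith⟩
      · rintro ⟨k, hk⟩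
        have : (0 : ℝ) < 1 / ((k : ℝ) + 1) := by positivity
        linarith
    rw [e, Monotone.measure_iUnion] at h
    · obtain ⟨k, hk⟩ := lt_iSup_iff.1 h
      have h1 : (0 : ℝ) < 1 / ((k : ℝ) + 1) := by positivity
      have := le_csSup hbdd hk
      exact lt_of_lt_of_le (by linarith) this
    · intro i j hij y hy
      have hy : t + 1 / ((i : ℝ) + 1) < u y := hy
      refine lt_of_le_of_lt ?_ hy
      have : 1 / ((j : ℝ) + 1) ≤ 1 / ((i : ℝ) + 1) := by gcongr
      linarith

lemma rearr_level {n : ℕ} {M : ℝ} {u : Euc n → ℝ} (h0 : ∀ x, 0 ≤ u x) (hM : ∀ x, u x ≤ M)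
    (hn : 2 ≤ n) {t : ℝ} (hfin : volume {y | t < u y} ≠ ⊤) :
    ∃ r : ℝ, 0 ≤ r ∧ {x | t < rearr u x} = ball 0 r ∧
      volume (ball (0 : Euc n) r) = volume {y | t < u y} := by
  obtain ⟨r, hr, hv⟩ := exists_radius hn hfin
  refine ⟨r, hr, ?_, hv⟩
  ext x
  simp only [mem_ofPred_eq]
  rw [lt_rearr h0 hM hn, ← hv, vol_ball_lt hn (norm_nonneg _) hr, mem_ball_zero_iff]

lemma rearr_nonneg {n : ℕ} {M : ℝ} {u : Euc n → ℝ} (h0 : ∀ x, 0 ≤ u x) (hM : ∀ x, u x ≤ M)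
    (hn : 2 ≤ n) (x : Euc n) : 0 ≤ rearr u x := by
  have := nontriv hn
  apply le_of_forall_lt
  intro t ht
  rw [lt_rearr h0 hM hn]
  have : {y | t < u y} = univ := by
    ext y; simpa using lt_of_lt_of_le ht (h0 y)
  rw [this, measure_univ_of_isAddLeftInvariant]
  exact measure_ball_lt_top

lemma rearr_le {n : ℕ} {M : ℝ} {u : Euc n → ℝ} (h0 : ∀ x, 0 ≤ u x) (hM : ∀ x, u x ≤ M)
    (hn : 2 ≤ n) (x : Euc n) : rearr u x ≤ M := by
  by_contra h
  rw [not_le, lt_rearr h0 hM hn] at h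
  have : {y | M < u y} = ∅ := by
    ext y; simpa using hM y
  simp [this] at h

lemma measurable_rearr {n : ℕ} {M : ℝ} {u : Euc n → ℝ} (h0 : ∀ x, 0 ≤ u x) (hM : ∀ x, u x ≤ M)
    (hn : 2 ≤ n) (hfin : ∀ t, 0 ≤ t → volume {y | t < u y} ≠ ⊤) : Measurable (rearr u) := by
  apply measurable_of_Ioi
  intro t
  have e : rearr u ⁻¹' Ioi t = {x | t < rearr u x} := rfl
  rw [e]
  by_cases ht : 0 ≤ t
  · obtain ⟨r, -, h, -⟩ := rearr_level h0 hM hn (hfin t ht)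
    rw [h]; exact measurableSet_ball
  · have : {x | t < rearr u x} = univ := by
      ext y; simpa using lt_of_lt_of_le (not_le.1 ht) (rearr_nonneg h0 hM hn y)
    rw [this]; exact MeasurableSet.univ

lemma rearr_supS_level {n : ℕ} {M : ℝ} {u : Euc n → ℝ} (hu : Continuous u) (h0 : ∀ x, 0 ≤ u x)
    (hM : ∀ x, u x ≤ M) (hn : 2 ≤ n) {t : ℝ} (hfin : volume {y | t < u y} ≠ ⊤) {s : ℝ}
    (hs : 0 < s) :
    ∃ r : ℝ, 0 ≤ r ∧ {x | t < supS s (rearr u) x} = ball 0 r ∧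
      volume (ball (0 : Euc n) r) ≤ volume {y | t < supS s u y} := by
  obtain ⟨r, hr, he, hv⟩ := rearr_level h0 hM hn hfin
  rw [lt_supS (rearr_le h0 hM hn) hs, lt_supS hM hs, he]
  rcases hr.eq_or_lt with rfl | hr
  · exact ⟨0, le_rfl, by simp, by simp⟩
  · refine ⟨r + s, by positivity, ?_, ?_⟩
    · rw [thickening_ball hs hr, add_comm]
    · exact bm_ball hn (isOpen_lt continuous_const hu) hr hs hv.le

lemma vol_triangle (G F : ℝ) (h : G ≤ F) :
    volume {z : ℝ × ℝ | G ≤ z.1 ∧ z.1 < z.2 ∧ z.2 < F} = ENNReal.ofReal ((F - G) ^ 2 / 2) := by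
  have hm : MeasurableSet {z : ℝ × ℝ | G ≤ z.1 ∧ z.1 < z.2 ∧ z.2 < F} :=
    (measurableSet_le measurable_const measurable_fst).inter
      ((measurableSet_lt measurable_fst measurable_snd).inter
        (measurableSet_lt measurable_snd measurable_const))
  rw [Measure.volume_eq_prod, Measure.prod_apply hm]
  have : ∀ a : ℝ, volume (Prod.mk a ⁻¹' {z : ℝ × ℝ | G ≤ z.1 ∧ z.1 < z.2 ∧ z.2 < F}) =
      (Icc G F).indicator (fun a => ENNReal.ofReal (F - a)) a := by
    intro a
    by_cases ha : a ∈ Icc G F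
    · rw [indicator_of_mem ha, ← Real.volume_Ioo]
      congr 1
      ext b
      simp [ha.1]
    · rw [indicator_of_notMem ha]
      convert measure_empty (μ := (volume : Measure ℝ))
      ext b
      simp only [mem_preimage, mem_ofPred_eq, mem_empty_iff_false, iff_false]
      rintro ⟨h1, h2, h3⟩
      exact ha ⟨h1, (h2.trans h3).le⟩
  simp_rw [this]
  rw [lintegral_indicator measurableSet_Icc, ← ofReal_integral_eq_lintegral_ofReal]
  · congr 1
    rw [integral_Icc_eq_integral_Ioc, ← intervalIntegral.integral_of_le h]
    rw [intervalIntegral.integral_sub (by simp) (by simp)]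
    simp only [intervalIntegral.integral_const, integral_id, smul_eq_mul]
    ring
  · exact (continuous_const.sub continuous_id).integrableOn_Icc
  · filter_upwards [ae_restrict_mem measurableSet_Icc] with a ha
    simpa using ha.2

lemma lintegral_sq_diff {n : ℕ} {f g : Euc n → ℝ} (hf : Measurable f) (hg : Measurable g)
    (hgf : ∀ x, g x ≤ f x) :
    ∫⁻ x, ENNReal.ofReal ((f x - g x) ^ 2 / 2) =
      ∫⁻ z : ℝ × ℝ, volume {x | g x ≤ z.1 ∧ z.1 < z.2 ∧ z.2 < f x} := by
  have hm : MeasurableSet {y : Euc n × (ℝ × ℝ) | g y.1 ≤ y.2.1 ∧ y.2.1 < y.2.2 ∧ y.2.2 < f y.1} :=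
    (measurableSet_le (hg.comp measurable_fst) (measurable_fst.comp measurable_snd)).inter
      ((measurableSet_lt (measurable_fst.comp measurable_snd)
        (measurable_snd.comp measurable_snd)).inter
        (measurableSet_lt (measurable_snd.comp measurable_snd) (hf.comp measurable_fst)))
  have h1 := Measure.prod_apply (μ := (volume : Measure (Euc n)))
    (ν := (volume : Measure (ℝ × ℝ))) hm
  have h2 := Measure.prod_apply_symm (μ := (volume : Measure (Euc n)))
    (ν := (volume : Measure (ℝ × ℝ))) hm
  rw [h1] at h2
  refine Eq.trans (lintegral_congr fun x => ?_) h2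
  rw [← vol_triangle _ _ (hgf x)]
  rfl

lemma rearr_sq_le {n : ℕ} {M : ℝ} {u : Euc n → ℝ} (hu : Continuous u) (h0 : ∀ x, 0 ≤ u x)
    (hM : ∀ x, u x ≤ M) (hn : 2 ≤ n) (hfin : ∀ t, 0 ≤ t → volume {y | t < u y} ≠ ⊤) {s : ℝ}
    (hs : 0 < s) :
    ∫⁻ x, ENNReal.ofReal ((supS s (rearr u) x - rearr u x) ^ 2 / 2) ≤
      ∫⁻ x, ENNReal.ofReal ((supS s u x - u x) ^ 2 / 2) := by
  have hwM := rearr_le h0 hM hn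
  rw [lintegral_sq_diff (measurable_supS hwM hs) (measurable_rearr h0 hM hn hfin)
      (fun x => le_supS hwM (by simpa using hs)),
    lintegral_sq_diff (measurable_supS hM hs) hu.measurable
      (fun x => le_supS hM (by simpa using hs))]
  apply lintegral_mono
  rintro ⟨a, b⟩
  simp only
  by_cases hab : a < b
  swap
  · simp [hab]
  by_cases ha : 0 ≤ a
  swap
  · have : {x | rearr u x ≤ a ∧ a < b ∧ b < supS s (rearr u) x} = ∅ := by
      ext x
      simp only [mem_ofPred_eq, mem_empty_iff_false, iff_false]
      rintro ⟨h, -⟩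
      exact ha ((rearr_nonneg h0 hM hn x).trans h)
    rw [this]; simp
  have hb : 0 ≤ b := ha.trans hab.le
  obtain ⟨r, hr, he, hv⟩ := rearr_level h0 hM hn (hfin a ha)
  obtain ⟨ρ, hρ, he', hv'⟩ := rearr_supS_level hu h0 hM hn (hfin b hb) hs
  have e1 : {x | rearr u x ≤ a ∧ a < b ∧ b < supS s (rearr u) x} = ball 0 ρ \ ball 0 r := by
    rw [← he, ← he']
    ext x; simp [hab, and_comm]
  have e2 : {x | u x ≤ a ∧ a < b ∧ b < supS s u x} = {x | b < supS s u x} \ {x | a < u x} := by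
    ext x; simp [hab, and_comm]
  rw [e1, e2]
  refine le_trans ?_ le_measure_sdiff
  rw [← hv]
  refine le_trans ?_ (tsub_le_tsub_right hv' _)
  rcases le_total r ρ with h | h
  · rw [measure_sdiff (ball_subset_ball h) measurableSet_ball.nullMeasurableSet
      measure_ball_lt_top.ne]
  · rw [sdiff_eq_empty.2 (ball_subset_ball h)]; simp

lemma rearr_meas {n : ℕ} {M : ℝ} {u : Euc n → ℝ} (h0 : ∀ x, 0 ≤ u x) (hM : ∀ x, u x ≤ M)
    (hn : 2 ≤ n) (hfin : ∀ t, 0 ≤ t → volume {y | t < u y} ≠ ⊤) {t : ℝ} (ht : 0 ≤ t) :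
    volume {x | t < rearr u x} = volume {x | t < u x} := by
  obtain ⟨r, hr, he, hv⟩ := rearr_level h0 hM hn (hfin t ht)
  rw [he, hv]

lemma rearr_lint {n : ℕ} {M : ℝ} {u : Euc n → ℝ} (hu : Continuous u) (h0 : ∀ x, 0 ≤ u x)
    (hM : ∀ x, u x ≤ M) (hn : 2 ≤ n) (hfin : ∀ t, 0 ≤ t → volume {y | t < u y} ≠ ⊤) :
    ∫⁻ x, ENNReal.ofReal (rearr u x) = ∫⁻ x, ENNReal.ofReal (u x) := by
  rw [lintegral_eq_lintegral_meas_lt _ (ae_of_all _ h0) hu.measurable.aemeasurable,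
    lintegral_eq_lintegral_meas_lt _ (ae_of_all _ (rearr_nonneg h0 hM hn))
      (measurable_rearr h0 hM hn hfin).aemeasurable]
  refine setLIntegral_congr_fun measurableSet_Ioi fun t ht => ?_
  exact rearr_meas h0 hM hn hfin (le_of_lt ht)

lemma rearr_lint_sq {n : ℕ} {M : ℝ} {u : Euc n → ℝ} (hu : Continuous u) (h0 : ∀ x, 0 ≤ u x)
    (hM : ∀ x, u x ≤ M) (hn : 2 ≤ n) (hfin : ∀ t, 0 ≤ t → volume {y | t < u y} ≠ ⊤) :
    ∫⁻ x, ENNReal.ofReal (rearr u x ^ 2) = ∫⁻ x, ENNReal.ofReal (u x ^ 2) := by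
  rw [lintegral_eq_lintegral_meas_lt _ (ae_of_all _ fun x => sq_nonneg (u x))
      (hu.measurable.pow_const 2).aemeasurable,
    lintegral_eq_lintegral_meas_lt _ (ae_of_all _ fun x => sq_nonneg (rearr u x))
      ((measurable_rearr h0 hM hn hfin).pow_const 2).aemeasurable]
  refine setLIntegral_congr_fun measurableSet_Ioi fun t ht => ?_
  have e : ∀ y : ℝ, 0 ≤ y → (t < y ^ 2 ↔ √t < y) := fun y hy => by
    rw [← Real.sqrt_lt_sqrt_iff (le_of_lt ht), Real.sqrt_sq hy]
  simp only [e _ (h0 _), e _ (rearr_nonneg h0 hM hn _)]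
  exact rearr_meas h0 hM hn hfin (Real.sqrt_nonneg t)

lemma unif_diff {n : ℕ} {φ : Euc n → ℝ} (h : ContDiff ℝ (⊤ : ℕ∞) φ) (hc : HasCompactSupport φ)
    {ε : ℝ} (hε : 0 < ε) :
    ∃ δ : ℝ, 0 < δ ∧ ∀ x y : Euc n, dist y x < δ →
      |φ y - φ x - fderiv ℝ φ x (y - x)| ≤ ε * ‖y - x‖ := by
  have hcont : Continuous (fderiv ℝ φ) := h.continuous_fderiv (by simp)
  have huc : UniformContinuous (fderiv ℝ φ) :=
    (hc.fderiv ℝ).uniformContinuous_of_continuous hcont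
  obtain ⟨δ, hδ, H⟩ := Metric.uniformContinuous_iff.1 huc ε hε
  refine ⟨δ, hδ, fun x y hxy => ?_⟩
  have := (convex_ball x δ).norm_image_sub_le_of_norm_fderiv_le' (𝕜 := ℝ) (f := φ) (C := ε)
    (φ := fderiv ℝ φ x) (x := x) (y := y)
    (fun z _ => (h.differentiable (by simp)) z)
    (fun z hz => by rw [← dist_eq_norm]; exact (H hz).le)
    (mem_ball_self hδ) hxy
  simpa using this

lemma sq_add_le {a b ε : ℝ} (hε : 0 < ε) : (a + ε * b) ^ 2 ≤ (1 + ε) * a ^ 2 + (ε ^ 2 + ε) * b ^ 2 := by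
  nlinarith [mul_nonneg hε.le (sq_nonneg (a - b))]

/-- upper bound for the oscillation -/
lemma osc_upper {n : ℕ} {φ : Euc n → ℝ} (h : ContDiff ℝ (⊤ : ℕ∞) φ) (hc : HasCompactSupport φ)
    {ε : ℝ} (hε : 0 < ε) :
    ∃ δ : ℝ, 0 < δ ∧ ∀ s : ℝ, 0 < s → s < δ → ∀ x,
      (supS s (fun x => |φ x|) x - |φ x|) ≤
        s * (‖fderiv ℝ φ x‖ + ε * (cthickening 1 (tsupport φ)).indicator 1 x) := by
  obtain ⟨δ, hδ, H⟩ := unif_diff h hc hε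
  refine ⟨min δ 1, lt_min hδ one_pos, fun s hs hsδ x => ?_⟩
  rw [sub_le_iff_le_add]
  apply supS_le hs
  intro y hy
  by_cases hx : x ∈ cthickening 1 (tsupport φ)
  · rw [indicator_of_mem hx]
    have h1 := H x y (hy.trans (hsδ.trans_le (min_le_left _ _)))
    have h2 := (fderiv ℝ φ x).le_opNorm (y - x)
    have h3 : ‖y - x‖ ≤ s := by rw [← dist_eq_norm]; exact hy.le
    rw [Real.norm_eq_abs] at h2
    have h4 : |φ y| - |φ x| ≤ |φ y - φ x| := abs_sub_abs_le_abs_sub _ _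
    have h5 : |φ y - φ x| ≤ |φ y - φ x - fderiv ℝ φ x (y - x)| + |fderiv ℝ φ x (y - x)| := by
      have := abs_add_le (φ y - φ x - fderiv ℝ φ x (y - x)) (fderiv ℝ φ x (y - x))
      simpa using this
    have h6 : ‖fderiv ℝ φ x‖ * ‖y - x‖ ≤ ‖fderiv ℝ φ x‖ * s := by gcongr
    have h7 : ε * ‖y - x‖ ≤ ε * s := by gcongr
    simp only [Pi.one_apply]
    nlinarith
  · have : φ y = 0 := by
      by_contra hne
      apply hx
      apply mem_cthickening_of_dist_le x y 1 _ (subset_tsupport _ hne)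
      rw [dist_comm]; exact (hy.trans (hsδ.trans_le (min_le_right _ _))).le
    rw [this, indicator_of_notMem hx, abs_zero]
    positivity

lemma osc_lower {n : ℕ} {φ : Euc n → ℝ} (h : ContDiff ℝ (⊤ : ℕ∞) φ) (hc : HasCompactSupport φ)
    {ε : ℝ} (hε : 0 < ε) :
    ∃ δ : ℝ, 0 < δ ∧ ∀ s : ℝ, 0 < s → s < δ → ∀ x (A : ℝ),
      (∀ y, dist y x < s → φ y - φ x ≤ A) →
      s * ‖fderiv ℝ φ x‖ ≤ A + s * (ε * (tsupport φ).indicator 1 x) := by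
  obtain ⟨δ, hδ, H⟩ := unif_diff h hc hε
  refine ⟨δ, hδ, fun s hs hsδ x A hA => ?_⟩
  have hA0 : 0 ≤ A := by simpa using hA x (by simpa using hs)
  by_cases hx : x ∈ tsupport φ
  swap
  · have h0 : fderiv ℝ φ x = 0 := by
      by_contra hne
      exact hx (support_fderiv_subset ℝ hne)
    rw [h0, indicator_of_notMem hx]; simpa using hA0
  rw [indicator_of_mem hx]
  simp only [Pi.one_apply, mul_one]
  set g := gradient φ x with hg
  have hgn : ‖fderiv ℝ φ x‖ = ‖g‖ := by simp [hg, gradient]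
  have hgg : fderiv ℝ φ x g = ‖g‖ ^ 2 := by
    rw [← real_inner_self_eq_norm_sq, hg, gradient, InnerProductSpace.toDual_symm_apply]
  rw [hgn]
  by_cases hg0 : g = 0
  · rw [hg0]; simp; positivity
  have hgpos : 0 < ‖g‖ := norm_pos_iff.2 hg0
  have key : ∀ t ∈ Ioo 0 s, t * ‖g‖ ≤ A + t * ε := by
    intro t ht
    have hn : ‖(t / ‖g‖) • g‖ = t := by
      rw [norm_smul, Real.norm_eq_abs, abs_of_pos (div_pos ht.1 hgpos)]; field_simp
    have hd : dist (x + (t / ‖g‖) • g) x = t := by rw [dist_eq_norm, add_sub_cancel_left, hn]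
    have h1 := hA (x + (t / ‖g‖) • g) (by rw [hd]; exact ht.2)
    have h2 := H x (x + (t / ‖g‖) • g) (by rw [hd]; exact ht.2.trans hsδ)
    rw [add_sub_cancel_left, hn, map_smul, hgg, smul_eq_mul] at h2
    have h3 : t / ‖g‖ * ‖g‖ ^ 2 = t * ‖g‖ := by field_simp
    rw [h3] at h2
    have := (abs_le.1 h2).1
    linarith
  have c1 : Tendsto (fun t : ℝ => t * ‖g‖) (𝓝[<] s) (𝓝 (s * ‖g‖)) :=
    ((continuous_id.mul continuous_const).tendsto s).mono_left nhdsWithin_le_nhds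
  have c2 : Tendsto (fun t : ℝ => A + t * ε) (𝓝[<] s) (𝓝 (A + s * ε)) :=
    ((continuous_const.add (continuous_id.mul continuous_const)).tendsto s).mono_left
      nhdsWithin_le_nhds
  refine le_of_tendsto_of_tendsto c1 c2 ?_
  filter_upwards [Ioo_mem_nhdsLT hs] with t ht using key t ht

/-- bounded measurable with bounded support -/
structure Nice {n : ℕ} (r M : ℝ) (g : Euc n → ℝ) : Prop where
  meas : Measurable g
  nonneg : ∀ x, 0 ≤ g x
  le : ∀ x, g x ≤ M
  zero : ∀ x, r < ‖x‖ → g x = 0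

lemma Nice.integrable {n : ℕ} {r M : ℝ} {g : Euc n → ℝ} (h : Nice r M g) : Integrable g := by
  have : IntegrableOn g (closedBall 0 r) := by
    refine Measure.integrableOn_of_bounded (M := M) measure_closedBall_lt_top.ne
      h.meas.aestronglyMeasurable (ae_of_all _ fun x => ?_)
    rw [Real.norm_eq_abs, abs_of_nonneg (h.nonneg x)]; exact h.le x
  refine (integrableOn_iff_integrable_of_support_subset fun x hx => ?_).1 this
  rw [mem_closedBall_zero_iff]
  by_contra hc
  exact hx (h.zero x (not_le.1 hc))

lemma Nice.sq {n : ℕ} {r M : ℝ} {g : Euc n → ℝ} (h : Nice r M g) :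
    Nice r (M ^ 2) (fun x => g x ^ 2) where
  meas := h.meas.pow_const 2
  nonneg x := sq_nonneg _
  le x := pow_le_pow_left₀ (h.nonneg x) (h.le x) 2
  zero x hx := by simp [h.zero x hx]

/-- standard bump -/
def bmp (n : ℕ) (δ : ℝ) (hδ : 0 < δ) : ContDiffBump (0 : Euc n) :=
  ⟨δ / 2, δ, by positivity, by linarith⟩

/-- mollification -/
def mol {n : ℕ} (b : ContDiffBump (0 : Euc n)) (g : Euc n → ℝ) : Euc n → ℝ :=
  convolution (b.normed volume) g (ContinuousLinearMap.lsmul ℝ ℝ) volume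

lemma mol_apply {n : ℕ} (b : ContDiffBump (0 : Euc n)) (g : Euc n → ℝ) (x : Euc n) :
    mol b g x = ∫ t, b.normed volume t * g (x - t) := rfl

lemma mol_integrable {n : ℕ} (b : ContDiffBump (0 : Euc n)) {r M : ℝ} {g : Euc n → ℝ}
    (h : Nice r M g) (x : Euc n) : Integrable fun t => b.normed volume t * g (x - t) :=
  (b.hasCompactSupport_normed (μ := volume)).convolutionExists_left
    (ContinuousLinearMap.lsmul ℝ ℝ) b.continuous_normed h.integrable.locallyIntegrable x

lemma mol_contDiff {n : ℕ} (b : ContDiffBump (0 : Euc n)) {r M : ℝ} {g : Euc n → ℝ}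
    (h : Nice r M g) : ContDiff ℝ (⊤ : ℕ∞) (mol b g) :=
  (b.hasCompactSupport_normed (μ := volume)).contDiff_convolution_left _ b.contDiff_normed
    h.integrable.locallyIntegrable

lemma mol_nonneg {n : ℕ} (b : ContDiffBump (0 : Euc n)) {r M : ℝ} {g : Euc n → ℝ}
    (h : Nice r M g) (x : Euc n) : 0 ≤ mol b g x :=
  integral_nonneg fun t => mul_nonneg (b.nonneg_normed t) (h.nonneg _)

lemma mol_le {n : ℕ} (b : ContDiffBump (0 : Euc n)) {r M : ℝ} {g : Euc n → ℝ}
    (h : Nice r M g) (x : Euc n) : mol b g x ≤ M := by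
  rw [mol_apply]
  calc ∫ t, b.normed volume t * g (x - t) ≤ ∫ t, b.normed volume t * M := by
        refine integral_mono (mol_integrable b h x) (b.integrable_normed.mul_const _) fun t => ?_
        exact mul_le_mul_of_nonneg_left (h.le _) (b.nonneg_normed t)
    _ = M := by rw [integral_mul_const, b.integral_normed, one_mul]

lemma mol_zero {n : ℕ} (b : ContDiffBump (0 : Euc n)) {r M : ℝ} {g : Euc n → ℝ}
    (h : Nice r M g) (x : Euc n) (hx : r + b.rOut < ‖x‖) : mol b g x = 0 := by
  rw [mol_apply]
  refine integral_eq_zero_of_ae (ae_of_all _ fun t => ?_)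
  by_cases ht : ‖t‖ < b.rOut
  · have : r < ‖x - t‖ := by
      have := norm_sub_norm_le x t
      linarith
    simp [h.zero _ this]
  · have : b.normed volume t = 0 := by
      by_contra hne
      have : t ∈ Function.support (b.normed volume) := hne
      rw [b.support_normed_eq, mem_ball_zero_iff] at this
      exact ht this
    simp [this]

lemma mol_nice {n : ℕ} (b : ContDiffBump (0 : Euc n)) {r M : ℝ} {g : Euc n → ℝ}
    (h : Nice r M g) : Nice (r + b.rOut) M (mol b g) where
  meas := (mol_contDiff b h).continuous.measurable
  nonneg := mol_nonneg b h
  le := mol_le b h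
  zero := mol_zero b h

lemma mol_int {n : ℕ} (b : ContDiffBump (0 : Euc n)) {r M : ℝ} {g : Euc n → ℝ}
    (h : Nice r M g) : ∫ x, mol b g x = ∫ x, g x := by
  unfold mol
  rw [integral_convolution _ b.integrable_normed h.integrable, b.integral_normed]
  simp

lemma mol_sq {n : ℕ} (b : ContDiffBump (0 : Euc n)) {r M : ℝ} {g : Euc n → ℝ}
    (h : Nice r M g) : ∫ x, mol b g x ^ 2 ≤ ∫ x, g x ^ 2 := by
  rw [← mol_int b h.sq]
  refine integral_mono (mol_nice b h).sq.integrable (mol_nice b h.sq).integrable fun x => ?_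
  set m := mol b g x with hm
  have h1 := mol_integrable b h x
  have h2 := mol_integrable b h.sq x
  have h3 : 0 ≤ ∫ t, b.normed volume t * (g (x - t) - m) ^ 2 :=
    integral_nonneg fun t => mul_nonneg (b.nonneg_normed t) (sq_nonneg _)
  have h4 : ∫ t, b.normed volume t * (g (x - t) - m) ^ 2 =
      ∫ t, (b.normed volume t * g (x - t) ^ 2 - 2 * m * (b.normed volume t * g (x - t))
        + m ^ 2 * b.normed volume t) := by
    congr 1; ext t; ring
  have h5 : Integrable (fun t => b.normed volume t * g (x - t) ^ 2 -
      2 * m * (b.normed volume t * g (x - t))) := h2.sub (h1.const_mul _)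
  rw [h4, integral_add h5 (b.integrable_normed.const_mul _),
    integral_sub h2 (h1.const_mul _), integral_const_mul, integral_const_mul, b.integral_normed,
    ← mol_apply b g x, ← mol_apply b (fun x => g x ^ 2) x, ← hm] at h3
  simp only
  nlinarith

lemma supS_nice {n : ℕ} {r M : ℝ} {g : Euc n → ℝ} (h : Nice r M g) {s : ℝ} (hs : 0 < s) :
    Nice (r + s) M (fun x => supS s g x - g x) where
  meas := (measurable_supS h.le hs).sub h.meas
  nonneg x := sub_nonneg.2 (le_supS h.le (by simpa using hs))
  le x := by
    have := supS_le hs (x := x) (f := g) (M := M) fun y _ => h.le y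
    have := h.nonneg x
    linarith
  zero x hx := by
    have h1 : supS s g x ≤ 0 := by
      refine supS_le hs fun y hy => (h.zero y ?_).le
      have := norm_sub_norm_le x y
      rw [dist_comm, dist_eq_norm] at hy
      linarith
    have h2 : g x ≤ supS s g x := le_supS h.le (by simpa using hs)
    have := h.nonneg x
    linarith

lemma mol_diff {n : ℕ} (b : ContDiffBump (0 : Euc n)) {r M : ℝ} {g : Euc n → ℝ}
    (h : Nice r M g) {s : ℝ} (hs : 0 < s) {x y : Euc n} (hy : dist y x < s) :
    mol b g y - mol b g x ≤ mol b (fun x => supS s g x - g x) x := by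
  rw [mol_apply, mol_apply, mol_apply, ← integral_sub (mol_integrable b h y) (mol_integrable b h x)]
  refine integral_mono ((mol_integrable b h y).sub (mol_integrable b h x))
    (mol_integrable b (supS_nice h hs) x) fun t => ?_
  simp only
  rw [← mul_sub]
  refine mul_le_mul_of_nonneg_left ?_ (b.nonneg_normed t)
  have : g (y - t) ≤ supS s g (x - t) := le_supS h.le (by simpa using hy)
  linarith

lemma int_fderiv {n : ℕ} {φ : Euc n → ℝ} (h : ContDiff ℝ (⊤ : ℕ∞) φ) (hc : HasCompactSupport φ) :
    Integrable fun x => ‖fderiv ℝ φ x‖ ^ 2 := by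
  have hcont : Continuous (fderiv ℝ φ) := h.continuous_fderiv (by simp)
  refine (hcont.norm.pow 2).integrable_of_hasCompactSupport ?_
  refine (hc.fderiv ℝ).mono' fun x hx => subset_tsupport _ ?_
  rw [Function.mem_support] at hx ⊢
  intro h0
  exact hx (by simp [h0])

lemma int_ind {n : ℕ} {K : Set (Euc n)} (hK : IsCompact K) :
    Integrable (fun x => (K.indicator (1 : Euc n → ℝ) x) ^ 2) := by
  have : (fun x => (K.indicator (1 : Euc n → ℝ) x) ^ 2) = K.indicator 1 := by
    ext x; by_cases hx : x ∈ K <;> simp [hx]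
  rw [this]
  exact (integrable_indicator_iff hK.measurableSet).2 
    (show IntegrableOn (fun _ => (1 : ℝ)) K from integrableOn_const (hs := hK.measure_lt_top.ne))

lemma mol_compact {n : ℕ} (b : ContDiffBump (0 : Euc n)) {r M : ℝ} {g : Euc n → ℝ}
    (h : Nice r M g) : tsupport (mol b g) ⊆ closedBall 0 (r + b.rOut) := by
  refine closure_minimal (fun x hx => ?_) isClosed_closedBall
  rw [mem_closedBall_zero_iff]
  by_contra hc
  exact hx (mol_zero b h x (not_le.1 hc))

lemma mol_compact' {n : ℕ} (b : ContDiffBump (0 : Euc n)) {r M : ℝ} {g : Euc n → ℝ}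
    (h : Nice r M g) : HasCompactSupport (mol b g) :=
  (isCompact_closedBall _ _).of_isClosed_subset (isClosed_tsupport _) (mol_compact b h)

lemma dir_le {n : ℕ} {φ w : Euc n → ℝ} (h : ContDiff ℝ (⊤ : ℕ∞) φ) (hc : HasCompactSupport φ)
    {r r' M : ℝ} (hw : Nice r M w) (hu : Nice r' M fun x => |φ x|)
    (H : ∀ s, 0 < s → ∫ x, (supS s w x - w x) ^ 2 ≤
      ∫ x, (supS s (fun x => |φ x|) x - |φ x|) ^ 2) (b : ContDiffBump (0 : Euc n)) :
    ∫ x, ‖fderiv ℝ (mol b w) x‖ ^ 2 ≤ ∫ x, ‖fderiv ℝ φ x‖ ^ 2 := by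
  set ψ := mol b w with hψ
  have hψs : ContDiff ℝ (⊤ : ℕ∞) ψ := mol_contDiff b hw
  have hψc : HasCompactSupport ψ := mol_compact' b hw
  set K := cthickening 1 (tsupport φ)
  have hK : IsCompact K := IsCompact.cthickening hc
  have hK' : IsCompact (tsupport ψ) := hψc
  set a := ∫ x, (K.indicator (1 : Euc n → ℝ) x) ^ 2
  set c := ∫ x, ((tsupport ψ).indicator (1 : Euc n → ℝ) x) ^ 2
  set D := ∫ x, ‖fderiv ℝ φ x‖ ^ 2
  have key : ∀ ε : ℝ, 0 < ε → ∫ x, ‖fderiv ℝ ψ x‖ ^ 2 ≤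
      (1 + ε) * ((1 + ε) * D + (ε ^ 2 + ε) * a) + (ε ^ 2 + ε) * c := by
    intro ε hε
    obtain ⟨δ₁, hδ₁, H1⟩ := osc_upper h hc hε
    obtain ⟨δ₂, hδ₂, H2⟩ := osc_lower hψs hψc hε
    obtain ⟨s, hs, hs'⟩ := exists_between (lt_min hδ₁ hδ₂)
    have hs1 := hs'.trans_le (min_le_left _ _)
    have hs2 := hs'.trans_le (min_le_right _ _)
    set A := mol b (fun x => supS s w x - w x)
    have hN := supS_nice hw hs
    have hNu := supS_nice hu hs
    have hA : Nice _ _ A := mol_nice b hN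
    have e1 : s ^ 2 * ∫ x, ‖fderiv ℝ ψ x‖ ^ 2 ≤ (1 + ε) * (∫ x, A x ^ 2) + (ε ^ 2 + ε) * s ^ 2 * c := by
      rw [← integral_const_mul, ← integral_const_mul, ← integral_const_mul, ← integral_add
        (hA.sq.integrable.const_mul _) ((int_ind hK').const_mul _)]
      refine integral_mono ((int_fderiv hψs hψc).const_mul _)
        ((hA.sq.integrable.const_mul _).add ((int_ind hK').const_mul _)) fun x => ?_
      simp only
      have := H2 s hs hs2 x (A x) fun y hy => mol_diff b hw hs hy
      have h3 := pow_le_pow_left₀ (by positivity) this 2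
      have h4 := sq_add_le (a := A x) (b := s * (tsupport ψ).indicator 1 x) hε
      calc _ = (s * ‖fderiv ℝ ψ x‖) ^ 2 := by ring
        _ ≤ _ := h3
        _ = (A x + ε * (s * (tsupport ψ).indicator 1 x)) ^ 2 := by ring
        _ ≤ _ := h4
        _ = _ := by ring
    have e2 : ∫ x, A x ^ 2 ≤ ∫ x, (supS s w x - w x) ^ 2 := mol_sq b hN
    have e3 := H s hs
    have e4 : ∫ x, (supS s (fun x => |φ x|) x - |φ x|) ^ 2 ≤
        s ^ 2 * ((1 + ε) * D + (ε ^ 2 + ε) * a) := by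
      rw [← integral_const_mul, ← integral_const_mul, ← integral_add
        ((int_fderiv h hc).const_mul _) ((int_ind hK).const_mul _), ← integral_const_mul]
      refine integral_mono hNu.sq.integrable
        ((((int_fderiv h hc).const_mul _).add ((int_ind hK).const_mul _)).const_mul _) fun x => ?_
      simp only
      have h3 := pow_le_pow_left₀ (hNu.nonneg x) (H1 s hs hs1 x) 2
      have h4 := sq_add_le (a := ‖fderiv ℝ φ x‖) (b := K.indicator 1 x) hε
      refine h3.trans ?_
      rw [mul_pow]
      exact mul_le_mul_of_nonneg_left h4 (by positivity)
    have hs2 : 0 < s ^ 2 := by positivity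
    refine le_of_mul_le_mul_left ?_ hs2
    refine e1.trans ?_
    have := mul_le_mul_of_nonneg_left (e2.trans (e3.trans e4)) (by positivity : 0 ≤ 1 + ε)
    nlinarith
  have lim : Tendsto (fun ε : ℝ => (1 + ε) * ((1 + ε) * D + (ε ^ 2 + ε) * a) + (ε ^ 2 + ε) * c)
      (𝓝[>] 0) (𝓝 D) := by
    have : Continuous (fun ε : ℝ => (1 + ε) * ((1 + ε) * D + (ε ^ 2 + ε) * a) + (ε ^ 2 + ε) * c) := by
      fun_prop
    have h := this.tendsto 0
    simp only [add_zero, one_mul, ne_eq, OfNat.ofNat_ne_zero, not_false_eq_true, zero_pow, zero_mul] at h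
    exact h.mono_left nhdsWithin_le_nhds
  refine ge_of_tendsto lim ?_
  filter_upwards [self_mem_nhdsWithin] with ε hε using key ε hε

lemma mol_sq_tendsto {n : ℕ} {r M : ℝ} {g : Euc n → ℝ} (h : Nice r M g) :
    Tendsto (fun k : ℕ => ∫ x, mol (bmp n (1 / ((k : ℝ) + 1)) (by positivity)) g x ^ 2) atTop
      (𝓝 (∫ x, g x ^ 2)) := by
  have hN := fun k : ℕ => mol_nice (bmp n (1 / ((k : ℝ) + 1)) (by positivity)) h
  have hr : ∀ k : ℕ, (bmp n (1 / ((k : ℝ) + 1)) (by positivity)).rOut = 1 / ((k : ℝ) + 1) :=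
    fun k => rfl
  refine tendsto_integral_of_dominated_convergence
    (fun x => (closedBall (0 : Euc n) (r + 1)).indicator (fun _ => M ^ 2) x) ?_ ?_ ?_ ?_
  · exact fun k => (hN k).sq.meas.aestronglyMeasurable
  · exact (integrable_indicator_iff measurableSet_closedBall).2
      (integrableOn_const (hs := measure_closedBall_lt_top.ne))
  · refine fun k => ae_of_all _ fun x => ?_
    rw [Real.norm_eq_abs, abs_of_nonneg (sq_nonneg _)]
    by_cases hx : x ∈ closedBall (0 : Euc n) (r + 1)
    · rw [indicator_of_mem hx]; exact (hN k).sq.le x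
    · rw [indicator_of_notMem hx]
      rw [mem_closedBall_zero_iff, not_le] at hx
      refine ((hN k).sq.zero x ?_).le
      rw [hr]
      have : 1 / ((k : ℝ) + 1) ≤ 1 := by
        rw [div_le_one (by positivity)]; linarith [(Nat.cast_nonneg k : (0 : ℝ) ≤ k)]
      linarith
  · have := ContDiffBump.ae_convolution_tendsto_right_of_locallyIntegrable (μ := volume) (K := 2) (l := atTop)
      (φ := fun k : ℕ => bmp n (1 / ((k : ℝ) + 1)) (by positivity)) (g := g) ?_ ?_
      h.integrable.locallyIntegrable
    · filter_upwards [this] with x hx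
      exact hx.pow 2
    · simp only [hr]; exact tendsto_one_div_add_atTop_nhds_zero_nat
    · refine Eventually.of_forall fun k => ?_
      show 1 / ((k : ℝ) + 1) ≤ 2 * (1 / ((k : ℝ) + 1) / 2)
      linarith

lemma polya_szego {n : ℕ} (hn : 2 ≤ n) {φ : Euc n → ℝ} (h : ContDiff ℝ (⊤ : ℕ∞) φ)
    (hc : HasCompactSupport φ) {r : ℝ} (hr : 0 < r)
    (hv : volume (Function.support φ) ≤ volume (ball (0 : Euc n) r)) {ε : ℝ} (hε : 0 < ε) :
    ∃ ψ : Euc n → ℝ, IsTestFun (ball 0 (r + ε)) ψ ∧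
      ∫ x, ‖fderiv ℝ ψ x‖ ^ 2 ≤ ∫ x, ‖fderiv ℝ φ x‖ ^ 2 ∧
      (∫ x, φ x ^ 2) - ε ≤ ∫ x, ψ x ^ 2 ∧ ∫ x, φ x ≤ ∫ x, ψ x := by
  have hφc := h.continuous
  obtain ⟨M, hM⟩ := hφc.bounded_above_of_compact_support hc
  simp only [Real.norm_eq_abs] at hM
  obtain ⟨r', hr'⟩ := hc.isCompact.isBounded.subset_closedBall (0 : Euc n)
  set u : Euc n → ℝ := fun x => |φ x| with hu
  have hucont : Continuous u := hφc.abs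
  have hu0 : ∀ x, 0 ≤ u x := fun x => abs_nonneg _
  have huN : Nice r' M u := ⟨hucont.measurable, hu0, hM, fun x hx => by
    have : x ∉ tsupport φ := fun h => by
      have := hr' h
      rw [mem_closedBall_zero_iff] at this
      linarith
    simp [hu, image_eq_zero_of_notMem_tsupport this]⟩
  have hsub : ∀ t, 0 ≤ t → {y | t < u y} ⊆ Function.support φ := fun t ht y hy => by
    simp only [mem_ofPred_eq, hu] at hy
    exact abs_pos.1 (ht.trans_lt hy)
  have hfin : ∀ t, 0 ≤ t → volume {y | t < u y} ≠ ⊤ := fun t ht =>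
    ((measure_mono (hsub t ht)).trans hv).trans_lt measure_ball_lt_top |>.ne
  set w := rearr u
  have hwN : Nice r M w := by
    refine ⟨measurable_rearr hu0 hM hn hfin, rearr_nonneg hu0 hM hn, rearr_le hu0 hM hn, ?_⟩
    intro x hx
    refine le_antisymm ?_ (rearr_nonneg hu0 hM hn x)
    obtain ⟨ρ, hρ, h1, h2⟩ := rearr_level hu0 hM hn (hfin 0 le_rfl)
    by_contra hcon
    rw [not_le] at hcon
    have hx2 : x ∈ ball (0 : Euc n) ρ := by rw [← h1]; exact hcon
    have : ρ ≤ r := by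
      by_contra hcc
      have := (vol_ball_lt hn hr.le hρ).2 (not_le.1 hcc)
      rw [h2] at this
      exact absurd ((measure_mono (hsub 0 le_rfl)).trans hv) (not_le.2 this)
    rw [mem_ball_zero_iff] at hx2
    linarith
  have H : ∀ s, 0 < s → ∫ x, (supS s w x - w x) ^ 2 ≤ ∫ x, (supS s u x - u x) ^ 2 := by
    intro s hs
    have h1 := rearr_sq_le hucont hu0 hM hn hfin hs
    have i1 := (supS_nice hwN hs).sq.integrable.div_const 2
    have i2 := (supS_nice huN hs).sq.integrable.div_const 2
    rw [← ofReal_integral_eq_lintegral_ofReal i1 (ae_of_all _ fun x => by positivity),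
      ← ofReal_integral_eq_lintegral_ofReal i2 (ae_of_all _ fun x => by positivity),
      ENNReal.ofReal_le_ofReal_iff (integral_nonneg fun x => by positivity),
      integral_div, integral_div] at h1
    linarith
  have hI : ∫ x, w x = ∫ x, u x := by
    have h1 := rearr_lint hucont hu0 hM hn hfin
    rw [← ofReal_integral_eq_lintegral_ofReal hwN.integrable (ae_of_all _ hwN.nonneg),
      ← ofReal_integral_eq_lintegral_ofReal huN.integrable (ae_of_all _ huN.nonneg)] at h1
    exact (ENNReal.ofReal_eq_ofReal_iff (integral_nonneg hwN.nonneg) (integral_nonneg hu0)).1 h1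
  have hI2 : ∫ x, w x ^ 2 = ∫ x, φ x ^ 2 := by
    have h1 := rearr_lint_sq hucont hu0 hM hn hfin
    rw [← ofReal_integral_eq_lintegral_ofReal hwN.sq.integrable (ae_of_all _ hwN.sq.nonneg),
      ← ofReal_integral_eq_lintegral_ofReal huN.sq.integrable (ae_of_all _ huN.sq.nonneg)] at h1
    have := (ENNReal.ofReal_eq_ofReal_iff (integral_nonneg hwN.sq.nonneg)
      (integral_nonneg huN.sq.nonneg)).1 h1
    rw [this]; simp [hu]
  have l1 := (tendsto_order.1 (mol_sq_tendsto hwN)).1 ((∫ x, w x ^ 2) - ε) (by linarith)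
  have l2 := (tendsto_order.1 (tendsto_one_div_add_atTop_nhds_zero_nat (𝕜 := ℝ))).2 ε hε
  obtain ⟨k, hk1, hk2⟩ := (l1.and l2).exists
  set b := bmp n (1 / ((k : ℝ) + 1)) (by positivity)
  refine ⟨mol b w, ⟨mol_contDiff b hwN, mol_compact' b hwN, (mol_compact b hwN).trans ?_⟩,
    dir_le h hc hwN huN H b, by rw [← hI2]; exact hk1.le, ?_⟩
  · refine closedBall_subset_ball ?_
    show r + 1 / ((k : ℝ) + 1) < r + ε
    linarith
  · rw [mol_int b hwN, hI]
    exact integral_mono (hφc.integrable_of_hasCompactSupport hc) huN.integrable fun x => le_abs_self _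

/-- Dirichlet energy -/
def Dir {n : ℕ} (φ : Euc n → ℝ) : ℝ := ∫ x, ‖fderiv ℝ φ x‖ ^ 2

lemma Dir_nonneg {n : ℕ} (φ : Euc n → ℝ) : 0 ≤ Dir φ := integral_nonneg fun _ => by positivity

lemma test_int {n : ℕ} {Ω : Set (Euc n)} {φ : Euc n → ℝ} (h : IsTestFun Ω φ) : Integrable φ :=
  h.1.continuous.integrable_of_hasCompactSupport h.2.1

lemma test_int_sq {n : ℕ} {Ω : Set (Euc n)} {φ : Euc n → ℝ} (h : IsTestFun Ω φ) :
    Integrable (fun x => φ x ^ 2) := by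
  refine (h.1.continuous.pow 2).integrable_of_hasCompactSupport ?_
  refine h.2.1.mono fun x hx => ?_
  rw [Function.mem_support] at hx ⊢
  intro h0
  exact hx (by simp [h0])

lemma poincare {n : ℕ} (hn : 2 ≤ n) : ∃ C : ℝ, 0 < C ∧ ∀ φ : Euc n → ℝ,
    IsTestFun (ball 0 1) φ → ∫ x, φ x ^ 2 ≤ C * Dir φ := by
  set C₀ : ℝ≥0 := eLpNormLESNormFDerivOfLeConst ℝ (volume : Measure (Euc n)) (ball (0 : Euc n) 1) 1 1
  refine ⟨4 * ((C₀ : ℝ) + 1) ^ 2, by positivity, fun φ hφ => ?_⟩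
  have hd : Differentiable ℝ φ := hφ.1.differentiable (by simp)
  have h1 : ContDiff ℝ 1 (fun x => φ x ^ 2) := (hφ.1.of_le (by simp)).pow 2
  have hs : Function.support (fun x => φ x ^ 2) ⊆ ball (0 : Euc n) 1 := by
    intro x hx
    refine hφ.2.2 (subset_tsupport _ ?_)
    rw [Function.mem_support] at hx ⊢
    intro h0
    exact hx (by simp [h0])
  have key := eLpNorm_le_eLpNorm_fderiv (volume : Measure (Euc n)) h1 hs (p := 1) le_rfl
    (by simp; omega) isBounded_ball
  have i1 := test_int_sq hφ
  have hfd : ∀ x, fderiv ℝ (fun x => φ x ^ 2) x = (2 * φ x) • fderiv ℝ φ x := by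
    intro x
    have := ((hd x).hasFDerivAt.pow 2).fderiv
    simpa using this
  have hcd : Continuous (fderiv ℝ φ) := hφ.1.continuous_fderiv (by simp)
  have i2 : Integrable (fderiv ℝ (fun x => φ x ^ 2)) := by
    refine (h1.continuous_fderiv (by simp)).integrable_of_hasCompactSupport ?_
    refine (hφ.2.1.fderiv ℝ).mono fun x hx => ?_
    rw [Function.mem_support] at hx ⊢
    intro h0
    exact hx (by rw [hfd, h0]; simp)
  simp only [ENNReal.coe_one, eLpNorm_one_eq_lintegral_enorm] at key
  rw [← ofReal_integral_norm_eq_lintegral_enorm i1, ← ofReal_integral_norm_eq_lintegral_enorm i2,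
    ← ENNReal.ofReal_coe_nnreal, ← ENNReal.ofReal_mul (by positivity),
    ENNReal.ofReal_le_ofReal_iff (by positivity)] at key
  have e1 : ∫ x, ‖φ x ^ 2‖ = ∫ x, φ x ^ 2 := by simp
  rw [e1] at key
  have e2 : (C₀ : ℝ) * ∫ x, ‖fderiv ℝ (fun x => φ x ^ 2) x‖ ≤
      ∫ x, ((1 / 2) * φ x ^ 2 + 2 * (C₀ + 1) ^ 2 * ‖fderiv ℝ φ x‖ ^ 2) := by
    rw [← integral_const_mul]
    refine integral_mono (i2.norm.const_mul _)
      ((i1.const_mul _).add ((int_fderiv hφ.1 hφ.2.1).const_mul _)) fun x => ?_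
    simp only
    rw [hfd, norm_smul, norm_mul, Real.norm_eq_abs, Real.norm_eq_abs, abs_two, ← sq_abs (φ x)]
    have hC : (0 : ℝ) ≤ C₀ := C₀.2
    set p := |φ x|
    set q := ‖fderiv ℝ φ x‖
    have hp : 0 ≤ p := abs_nonneg _
    have hq : 0 ≤ q := norm_nonneg _
    have := mul_nonneg hp hq
    nlinarith [sq_nonneg (p - 2 * (C₀ + 1) * q)]
  rw [integral_add (i1.const_mul _) ((int_fderiv hφ.1 hφ.2.1).const_mul _), integral_const_mul,
    integral_const_mul] at e2
  have e3 := key.trans e2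
  unfold Dir
  linarith

/-- eigenvalue of the unit ball (test functions) -/
def Lam (n : ℕ) : ℝ :=
  sInf {r | ∃ φ : Euc n → ℝ, IsTestFun (ball 0 1) φ ∧ (∫ x, φ x ^ 2) ≠ 0 ∧ r = Dir φ / ∫ x, φ x ^ 2}

/-- torsion of the unit ball (test functions) -/
def Tor0 (n : ℕ) : ℝ :=
  sInf {r | ∃ φ : Euc n → ℝ, IsTestFun (ball 0 1) φ ∧ r = (1 / 2) * Dir φ - ∫ x, φ x}

lemma sq_int_nonneg {n : ℕ} (φ : Euc n → ℝ) : 0 ≤ ∫ x, φ x ^ 2 := integral_nonneg fun _ => sq_nonneg _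

lemma exists_test {n : ℕ} {Ω : Set (Euc n)} (ho : IsOpen Ω) (hne : Ω.Nonempty) :
    ∃ φ : Euc n → ℝ, IsTestFun Ω φ ∧ (∫ x, φ x ^ 2) ≠ 0 := by
  obtain ⟨x, hx⟩ := hne
  obtain ⟨f, h1, h2, h3, -, h5⟩ := exists_contDiff_tsupport_subset (n := ⊤) (ho.mem_nhds hx)
  have ht : IsTestFun Ω f := ⟨h3, h2, h1⟩
  refine ⟨f, ht, ?_⟩
  have hc : Continuous (fun x => f x ^ 2) := h3.continuous.pow 2
  refine (hc.integral_pos_of_hasCompactSupport_nonneg_nonzero ?_ (fun x => sq_nonneg _) (x := x) (by simp [h5])).ne'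
  refine h2.mono fun x hx => ?_
  rw [Function.mem_support] at hx ⊢
  intro h0
  exact hx (by simp [h0])

lemma test_zero {n : ℕ} (Ω : Set (Euc n)) : IsTestFun Ω (fun _ => (0 : ℝ)) :=
  ⟨contDiff_const, HasCompactSupport.zero, by
    have : tsupport (fun _ : Euc n => (0 : ℝ)) = ∅ := by simp
    rw [this]; exact empty_subset _⟩

lemma Lam_pos {n : ℕ} (hn : 2 ≤ n) : 0 < Lam n := by
  obtain ⟨C, hC, H⟩ := poincare hn
  refine (inv_pos.2 hC).trans_le (le_csInf ?_ ?_)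
  · obtain ⟨φ, h1, h2⟩ := exists_test (Ω := ball (0 : Euc n) 1) isOpen_ball ⟨0, by simp⟩
    exact ⟨_, φ, h1, h2, rfl⟩
  · rintro _ ⟨φ, h1, h2, rfl⟩
    have h3 := lt_of_le_of_ne (sq_int_nonneg φ) h2.symm
    rw [le_div_iff₀ h3, inv_mul_le_iff₀ hC]
    exact H φ h1

lemma Lam_le {n : ℕ} {φ : Euc n → ℝ} (h : IsTestFun (ball 0 1) φ) :
    Lam n * ∫ x, φ x ^ 2 ≤ Dir φ := by
  by_cases h2 : (∫ x, φ x ^ 2) = 0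
  · rw [h2, mul_zero]; exact Dir_nonneg _
  have h3 := lt_of_le_of_ne (sq_int_nonneg φ) (Ne.symm h2)
  rw [← le_div_iff₀ h3]
  refine csInf_le ⟨0, ?_⟩ ⟨φ, h, h2, rfl⟩
  rintro _ ⟨φ, -, -, rfl⟩
  exact div_nonneg (Dir_nonneg _) (sq_int_nonneg _)

lemma Tor0_bdd {n : ℕ} (hn : 2 ≤ n) :
    BddBelow {r | ∃ φ : Euc n → ℝ, IsTestFun (ball 0 1) φ ∧ r = (1 / 2) * Dir φ - ∫ x, φ x} := by
  obtain ⟨C, hC, H⟩ := poincare hn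
  refine ⟨- (C / 2 * ∫ x, ((closedBall (0 : Euc n) 1).indicator (1 : Euc n → ℝ) x) ^ 2), ?_⟩
  rintro _ ⟨φ, h, rfl⟩
  have i3 := int_ind (isCompact_closedBall (0 : Euc n) 1)
  have h1 : ∫ x, φ x ≤ ∫ x, (1 / (2 * C) * φ x ^ 2 +
      C / 2 * ((closedBall (0 : Euc n) 1).indicator (1 : Euc n → ℝ) x) ^ 2) := by
    refine integral_mono (test_int h) (((test_int_sq h).const_mul _).add (i3.const_mul _)) fun x => ?_
    simp only
    by_cases hx : x ∈ closedBall (0 : Euc n) 1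
    · rw [indicator_of_mem hx]
      have : 1 / (2 * C) * φ x ^ 2 + C / 2 * (1 : Euc n → ℝ) x ^ 2 - φ x =
        1 / (2 * C) * (φ x - C) ^ 2 := by
        simp; field_simp; ring
      have h4 : 0 ≤ 1 / (2 * C) * (φ x - C) ^ 2 := by positivity
      linarith
    · have : φ x = 0 := image_eq_zero_of_notMem_tsupport fun hh =>
        hx (ball_subset_closedBall (h.2.2 hh))
      simp [this, hx]
  rw [integral_add ((test_int_sq h).const_mul _) (i3.const_mul _), integral_const_mul,
    integral_const_mul] at h1
  have h2 : 1 / (2 * C) * ∫ x, φ x ^ 2 ≤ 1 / 2 * Dir φ := by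
    calc _ ≤ 1 / (2 * C) * (C * Dir φ) := mul_le_mul_of_nonneg_left (H φ h) (by positivity)
      _ = _ := by field_simp
  linarith

lemma Tor0_le {n : ℕ} (hn : 2 ≤ n) {φ : Euc n → ℝ} (h : IsTestFun (ball 0 1) φ) :
    Tor0 n ≤ (1 / 2) * Dir φ - ∫ x, φ x := csInf_le (Tor0_bdd hn) ⟨φ, h, rfl⟩

lemma Tor0_nonpos {n : ℕ} (hn : 2 ≤ n) : Tor0 n ≤ 0 := by
  simpa [Dir] using Tor0_le hn (test_zero (n := n) (ball 0 1))

lemma scale {n : ℕ} {φ : Euc n → ℝ} {r ρ : ℝ} (c : ℝ) (hρ : 0 < ρ) (h : IsTestFun (ball 0 r) φ) :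
    IsTestFun (ball 0 (r / ρ)) (fun x => c * φ (ρ • x)) ∧
    (∫ x, (c * φ (ρ • x)) ^ 2) = c ^ 2 * (ρ ^ n)⁻¹ * ∫ x, φ x ^ 2 ∧
    Dir (fun x => c * φ (ρ • x)) = c ^ 2 * ρ ^ 2 * (ρ ^ n)⁻¹ * Dir φ ∧
    (∫ x, c * φ (ρ • x)) = c * (ρ ^ n)⁻¹ * ∫ x, φ x := by
  have hI : ∀ f : Euc n → ℝ, ∫ x, f (ρ • x) = (ρ ^ n)⁻¹ * ∫ x, f x := fun f => by
    have := Measure.integral_comp_smul_of_nonneg (volume : Measure (Euc n)) f ρ (hR := hρ.le)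
    simpa using this
  have hd : Differentiable ℝ φ := h.1.differentiable (by simp)
  have hts : tsupport (fun x => c * φ (ρ • x)) ⊆ (fun x => ρ • x) ⁻¹' tsupport φ := by
    refine closure_minimal (fun x hx => subset_tsupport _ ?_)
      ((isClosed_tsupport φ).preimage (continuous_const_smul ρ))
    rw [Function.mem_support] at hx ⊢
    intro h0
    exact hx (by simp [h0])
  refine ⟨⟨?_, ?_, ?_⟩, ?_, ?_, ?_⟩
  · exact contDiff_const.mul (h.1.comp (contDiff_id.const_smul ρ))
  · have : HasCompactSupport (fun x => φ (ρ • x)) := h.2.1.comp_smul hρ.ne'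
    exact this.mul_left
  · intro x hx
    have := h.2.2 (hts hx)
    rw [mem_ball_zero_iff, norm_smul, Real.norm_eq_abs, abs_of_pos hρ] at this
    rw [mem_ball_zero_iff, lt_div_iff₀ hρ]
    linarith
  · simp_rw [mul_pow]
    rw [integral_const_mul, hI (fun x => φ x ^ 2)]; ring
  · have : ∀ x, fderiv ℝ (fun x => c * φ (ρ • x)) x = (c * ρ) • fderiv ℝ φ (ρ • x) := by
      intro x
      rw [fderiv_const_mul (by fun_prop), fderiv_comp_smul, mul_smul]
    unfold Dir
    simp_rw [this, norm_smul, mul_pow]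
    rw [integral_const_mul, hI (fun x => ‖fderiv ℝ φ x‖ ^ 2)]
    simp [mul_pow, sq_abs]; ring
  · rw [integral_const_mul, hI φ]; ring

lemma ball_test {n : ℕ} (hn : 2 ≤ n) {φ : Euc n → ℝ} {r : ℝ} (hr : 0 < r)
    (h : IsTestFun (ball 0 r) φ) : Lam n * (∫ x, φ x ^ 2) ≤ r ^ 2 * Dir φ ∧
      Tor0 n * r ^ (n + 2) ≤ (1 / 2) * Dir φ - ∫ x, φ x := by
  have hp : 0 < r ^ n := by positivity
  constructor
  · obtain ⟨h1, h2, h3, -⟩ := scale 1 hr h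
    rw [div_self hr.ne'] at h1
    have := Lam_le h1
    rw [h2, h3] at this
    have := mul_le_mul_of_nonneg_left this hp.le
    calc _ = r ^ n * (Lam n * (1 ^ 2 * (r ^ n)⁻¹ * ∫ x, φ x ^ 2)) := by field_simp
      _ ≤ _ := this
      _ = _ := by field_simp
  · obtain ⟨h1, -, h3, h4⟩ := scale ((r ^ 2)⁻¹) hr h
    rw [div_self hr.ne'] at h1
    have := Tor0_le hn h1
    rw [h3, h4] at this
    have := mul_le_mul_of_nonneg_right this (by positivity : 0 ≤ r ^ (n + 2))
    refine this.trans (le_of_eq ?_)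
    rw [pow_add]; field_simp

lemma fk_test {n : ℕ} (hn : 2 ≤ n) {φ : Euc n → ℝ} {r : ℝ} (hr : 0 < r) {Ω : Set (Euc n)}
    (h : IsTestFun Ω φ) (hv : volume (Function.support φ) ≤ volume (ball (0 : Euc n) r)) :
    Lam n * (∫ x, φ x ^ 2) ≤ r ^ 2 * Dir φ ∧
      Tor0 n * r ^ (n + 2) ≤ (1 / 2) * Dir φ - ∫ x, φ x := by
  have H : ∀ ε : ℝ, 0 < ε → Lam n * ((∫ x, φ x ^ 2) - ε) ≤ (r + ε) ^ 2 * Dir φ ∧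
      Tor0 n * (r + ε) ^ (n + 2) ≤ (1 / 2) * Dir φ - ∫ x, φ x := by
    intro ε hε
    obtain ⟨ψ, h1, h2, h3, h4⟩ := polya_szego hn h.1 h.2.1 hr hv hε
    obtain ⟨h5, h6⟩ := ball_test hn (by positivity : 0 < r + ε) h1
    have h2' : Dir ψ ≤ Dir φ := h2
    constructor
    · calc _ ≤ Lam n * ∫ x, ψ x ^ 2 := mul_le_mul_of_nonneg_left h3 (Lam_pos hn).le
        _ ≤ _ := h5
        _ ≤ _ := mul_le_mul_of_nonneg_left h2' (by positivity)
    · linarith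
  have l : ∀ f : ℝ → ℝ, Continuous f → Tendsto f (𝓝[>] 0) (𝓝 (f 0)) := fun f hf =>
    (hf.tendsto 0).mono_left nhdsWithin_le_nhds
  have l1 := l (fun ε => Lam n * ((∫ x, φ x ^ 2) - ε)) (by fun_prop)
  have l2 := l (fun ε => (r + ε) ^ 2 * Dir φ) (by fun_prop)
  have l3 := l (fun ε => Tor0 n * (r + ε) ^ (n + 2)) (by fun_prop)
  simp only [sub_zero, add_zero] at l1 l2 l3
  constructor
  · refine le_of_tendsto_of_tendsto l1 l2 ?_
    filter_upwards [self_mem_nhdsWithin] with ε hε using (H ε hε).1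
  · refine le_of_tendsto l3 ?_
    filter_upwards [self_mem_nhdsWithin] with ε hε using (H ε hε).2

lemma norm_toLp_sq {n : ℕ} {F : Type*} [NormedAddCommGroup F] {f : Euc n → F}
    (h : MemLp f 2 volume) : ‖h.toLp f‖ ^ 2 = ∫ x, ‖f x‖ ^ 2 := by
  have h0 : 0 ≤ ∫ x, ‖f x‖ ^ 2 := integral_nonneg fun _ => by positivity
  rw [Lp.norm_toLp, h.eLpNorm_eq_integral_rpow_norm (by simp) (by simp)]
  simp only [ENNReal.toReal_ofNat, Real.rpow_ofNat]
  rw [ENNReal.toReal_ofReal (by positivity), ← Real.rpow_natCast, ← Real.rpow_mul h0]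
  norm_num

lemma toLp_tendsto {n : ℕ} {F : Type*} [NormedAddCommGroup F] {f : ℕ → Euc n → F} {g : Euc n → F}
    (hf : ∀ k, MemLp (f k) 2 volume) (hg : MemLp g 2 volume)
    (h : Tendsto (fun k => ∫ x, ‖f k x - g x‖ ^ 2) atTop (𝓝 0)) :
    Tendsto (fun k => (hf k).toLp (f k)) atTop (𝓝 (hg.toLp g)) := by
  rw [tendsto_iff_norm_sub_tendsto_zero]
  have e : ∀ k, ‖(hf k).toLp (f k) - hg.toLp g‖ = √(∫ x, ‖f k x - g x‖ ^ 2) := by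
    intro k
    rw [← MemLp.toLp_sub, ← Real.sqrt_sq (norm_nonneg (MemLp.toLp (f k - g) _)), norm_toLp_sq]
    rfl
  simp_rw [e]
  simpa using h.sqrt

lemma sq_tendsto {n : ℕ} {F : Type*} [NormedAddCommGroup F] {f : ℕ → Euc n → F} {g : Euc n → F}
    (hf : ∀ k, MemLp (f k) 2 volume) (hg : MemLp g 2 volume)
    (h : Tendsto (fun k => ∫ x, ‖f k x - g x‖ ^ 2) atTop (𝓝 0)) :
    Tendsto (fun k => ∫ x, ‖f k x‖ ^ 2) atTop (𝓝 (∫ x, ‖g x‖ ^ 2)) := by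
  have := ((toLp_tendsto hf hg h).norm.pow 2)
  simpa only [norm_toLp_sq] using this

lemma norm_gradient {n : ℕ} (φ : Euc n → ℝ) (x : Euc n) : ‖gradient φ x‖ = ‖fderiv ℝ φ x‖ := by
  simp [gradient]

lemma test_memLp {n : ℕ} {Ω : Set (Euc n)} {φ : Euc n → ℝ} (h : IsTestFun Ω φ) :
    MemLp φ 2 volume := h.1.continuous.memLp_of_hasCompactSupport h.2.1

lemma test_memLp_grad {n : ℕ} {Ω : Set (Euc n)} {φ : Euc n → ℝ} (h : IsTestFun Ω φ) :
    MemLp (gradient φ) 2 volume := by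
  have hc : Continuous (gradient φ) :=
    (InnerProductSpace.toDual ℝ (Euc n)).symm.continuous.comp (h.1.continuous_fderiv (by simp))
  refine hc.memLp_of_hasCompactSupport ((h.2.1.fderiv ℝ).mono fun x hx => ?_)
  rw [Function.mem_support] at hx ⊢
  intro h0
  exact hx (by simp [gradient, h0])

lemma dir_grad {n : ℕ} (φ : Euc n → ℝ) : ∫ x, ‖gradient φ x‖ ^ 2 = Dir φ := by
  simp_rw [norm_gradient]; rfl

lemma test_memH {n : ℕ} {Ω : Set (Euc n)} {φ : Euc n → ℝ} (h : IsTestFun Ω φ) :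
    MemH10 Ω φ (gradient φ) :=
  ⟨test_memLp h, test_memLp_grad h, fun _ => φ, fun _ => h, by simp, by simp⟩

lemma h10_lim {n : ℕ} {Ω : Set (Euc n)} {u : Euc n → ℝ} {Du : Euc n → Euc n} (h : MemH10 Ω u Du) :
    ∃ φ : ℕ → Euc n → ℝ, (∀ k, IsTestFun Ω (φ k)) ∧
      Tendsto (fun k => ∫ x, φ k x ^ 2) atTop (𝓝 (∫ x, u x ^ 2)) ∧
      Tendsto (fun k => Dir (φ k)) atTop (𝓝 (∫ x, ‖Du x‖ ^ 2)) ∧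
      (∀ k, MemLp (φ k) 2 volume) ∧ Tendsto (fun k => ∫ x, (φ k x - u x) ^ 2) atTop (𝓝 0) := by
  obtain ⟨h1, h2, φ, h3, h4, h5⟩ := h
  refine ⟨φ, h3, ?_, ?_, fun k => test_memLp (h3 k), h4⟩
  · have := sq_tendsto (fun k => test_memLp (h3 k)) h1 (by simpa using h4)
    simpa using this
  · have := sq_tendsto (fun k => test_memLp_grad (h3 k)) h2 h5
    simpa only [dir_grad] using this

lemma le_lam1 {n : ℕ} {Ω : Set (Euc n)} (ho : IsOpen Ω) (hne : Ω.Nonempty) {a : ℝ}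
    (H : ∀ φ, IsTestFun Ω φ → a * (∫ x, φ x ^ 2) ≤ Dir φ) : a ≤ lam1 Ω := by
  refine le_csInf ?_ ?_
  · obtain ⟨φ, h1, h2⟩ := exists_test ho hne
    exact ⟨_, φ, _, test_memH h1, h2, rfl⟩
  · rintro _ ⟨u, Du, h1, h2, rfl⟩
    have h3 := lt_of_le_of_ne (sq_int_nonneg u) h2.symm
    rw [le_div_iff₀ h3]
    obtain ⟨φ, h4, h5, h6, -⟩ := h10_lim h1
    exact le_of_tendsto_of_tendsto' (h5.const_mul a) h6 fun k => H _ (h4 k)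

lemma tor_aux {n : ℕ} {Ω : Set (Euc n)} (ho : IsOpen Ω) (hfin : volume Ω ≠ ⊤) {b : ℝ}
    (H : ∀ φ, IsTestFun Ω φ → b ≤ (1 / 2) * Dir φ - ∫ x, φ x) {w : Euc n → ℝ} {Dw : Euc n → Euc n}
    (h : MemH10 Ω w Dw) : b ≤ ∫ x, ((1 / 2) * ‖Dw x‖ ^ 2 - w x) := by
  obtain ⟨φ, h4, h5, h6, h7, h8⟩ := h10_lim h
  have hm := ho.measurableSet
  have hz : ∀ k x, x ∉ Ω → φ k x = 0 := fun k x hx =>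
    image_eq_zero_of_notMem_tsupport fun hh => hx ((h4 k).2.2 hh)
  have i1 : ∀ k, Integrable fun x => (φ k x - w x) ^ 2 := fun k => by
    have := ((h7 k).sub h.1).integrable_norm_pow (by norm_num)
    simpa using this
  have iw : Integrable fun x => w x ^ 2 := by
    have := h.1.integrable_norm_pow (by norm_num)
    simpa using this
  have hw0 : ∀ᵐ x ∂volume, x ∉ Ω → w x = 0 := by
    have e : ∫ x in Ωᶜ, w x ^ 2 = 0 := by
      refine le_antisymm (ge_of_tendsto' h8 fun k => ?_) (integral_nonneg fun _ => sq_nonneg _)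
      calc ∫ x in Ωᶜ, w x ^ 2 = ∫ x in Ωᶜ, (φ k x - w x) ^ 2 := by
            refine setIntegral_congr_fun hm.compl fun x hx => ?_
            simp [hz k x hx]
        _ ≤ _ := setIntegral_le_integral (i1 k) (ae_of_all _ fun _ => sq_nonneg _)
    rw [integral_eq_zero_iff_of_nonneg (fun _ => sq_nonneg _) iw.integrableOn] at e
    have := (ae_restrict_iff' hm.compl).1 e
    filter_upwards [this] with x hx hx2
    simpa using hx hx2
  have hwi : Integrable w := by
    have : IntegrableOn w Ω := by
      have : IsFiniteMeasure (volume.restrict Ω) := ⟨by simpa using hfin.lt_top⟩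
      exact (h.1.restrict Ω).integrable (by norm_num)
    refine (integrableOn_iff_integrable_of_support_subset (s := Ω) (f := Ω.indicator w) (μ := volume)
      (by simp)).1 ?_ |>.congr ?_
    · exact (integrableOn_congr_fun (fun x hx => by simp [hx]) hm).2 this
    · filter_upwards [hw0] with x hx
      by_cases hxx : x ∈ Ω
      · simp [hxx]
      · simp [hxx, hx hxx]
  have lim : Tendsto (fun k => ∫ x, φ k x) atTop (𝓝 (∫ x, w x)) := by
    have l1 := toLp_tendsto h7 h.1 (by simpa using h8)
    have l2 := (tendsto_const_nhds (x := indicatorConstLp 2 hm hfin (1 : ℝ))).inner (𝕜 := ℝ) l1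
    simp only [L2.inner_indicatorConstLp_one] at l2
    have e : ∀ f : Euc n → ℝ, ∀ hf : MemLp f 2 volume, (∀ᵐ x ∂volume, x ∉ Ω → f x = 0) →
        ∫ x in Ω, hf.toLp f x = ∫ x, f x := by
      intro f hf h0
      rw [← setIntegral_eq_integral_of_ae_compl_eq_zero h0]
      exact integral_congr_ae (ae_restrict_of_ae hf.coeFn_toLp)
    rw [e _ _ hw0] at l2
    refine l2.congr fun k => e _ _ (ae_of_all _ (hz k))
  have hDi : Integrable fun x => ‖Dw x‖ ^ 2 := h.2.1.integrable_norm_pow (by norm_num)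
  rw [integral_sub (hDi.const_mul _) hwi, integral_const_mul]
  exact ge_of_tendsto' ((h6.const_mul _).sub lim) fun k => H _ (h4 k)

lemma le_tor {n : ℕ} {Ω : Set (Euc n)} (ho : IsOpen Ω) (hfin : volume Ω ≠ ⊤) {b : ℝ}
    (H : ∀ φ, IsTestFun Ω φ → b ≤ (1 / 2) * Dir φ - ∫ x, φ x) : b ≤ tor Ω := by
  refine le_csInf ⟨_, _, _, test_memH (test_zero Ω), rfl⟩ ?_
  rintro _ ⟨w, Dw, h, rfl⟩
  exact tor_aux ho hfin H h

lemma lam1_ball {n : ℕ} {ρ : ℝ} (hρ : 0 < ρ) :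
    lam1 (ball (0 : Euc n) ρ) ≤ Lam n / ρ ^ 2 := by
  rw [le_div_iff₀ (by positivity)]
  refine le_csInf ?_ ?_
  · obtain ⟨φ, h1, h2⟩ := exists_test (Ω := ball (0 : Euc n) 1) isOpen_ball ⟨0, by simp⟩
    exact ⟨_, φ, h1, h2, rfl⟩
  · rintro _ ⟨φ, h1, h2, rfl⟩
    obtain ⟨h3, h4, h5, -⟩ := scale 1 (inv_pos.2 hρ) h1
    rw [div_inv_eq_mul, one_mul] at h3
    rw [← le_div_iff₀ (by positivity)]
    refine csInf_le ⟨0, ?_⟩ ⟨_, _, test_memH h3, ?_, ?_⟩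
    · rintro _ ⟨u, Du, -, -, rfl⟩
      exact div_nonneg (integral_nonneg fun _ => by positivity) (sq_int_nonneg _)
    · rw [h4]; positivity
    · rw [dir_grad, h4, h5]; field_simp

lemma tor_ball {n : ℕ} (hn : 2 ≤ n) {ρ : ℝ} (hρ : 0 < ρ) :
    tor (ball (0 : Euc n) ρ) ≤ Tor0 n * ρ ^ (n + 2) := by
  rw [← div_le_iff₀ (by positivity)]
  refine le_csInf ⟨_, _, test_zero _, rfl⟩ ?_
  rintro _ ⟨φ, h1, rfl⟩
  obtain ⟨h3, -, h5, h6⟩ := scale (ρ ^ 2) (inv_pos.2 hρ) h1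
  rw [div_inv_eq_mul, one_mul] at h3
  rw [div_le_iff₀ (by positivity)]
  refine csInf_le ⟨Tor0 n * ρ ^ (n + 2), ?_⟩ ⟨_, _, test_memH h3, ?_⟩
  · rintro _ ⟨w, Dw, h, rfl⟩
    exact tor_aux isOpen_ball measure_ball_lt_top.ne (fun φ hφ => (ball_test hn hρ hφ).2) h
  · have hi : Integrable fun x => ‖gradient (fun x => ρ ^ 2 * φ (ρ⁻¹ • x)) x‖ ^ 2 :=
      (test_memLp_grad h3).integrable_norm_pow (by norm_num)
    rw [integral_sub (hi.const_mul _) (test_int h3), integral_const_mul, dir_grad, h5, h6, pow_add]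
    simp only [inv_pow, inv_inv]
    field_simp

lemma supp_sub {n : ℕ} {Ω : Set (Euc n)} {φ : Euc n → ℝ} (h : IsTestFun Ω φ) :
    Function.support φ ⊆ Ω := (subset_tsupport _).trans h.2.2

lemma fk {n : ℕ} (hn : 2 ≤ n) {Ω : Set (Euc n)} (ho : IsOpen Ω) (hne : Ω.Nonempty) {r : ℝ}
    (hr : 0 < r) (hv : volume Ω ≤ volume (ball (0 : Euc n) r)) :
    Lam n / r ^ 2 ≤ lam1 Ω ∧ Tor0 n * r ^ (n + 2) ≤ tor Ω := by
  have H := fun φ (h : IsTestFun Ω φ) => fk_test hn hr h ((measure_mono (supp_sub h)).trans hv)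
  constructor
  · refine le_lam1 ho hne fun φ h => ?_
    rw [div_mul_eq_mul_div, div_le_iff₀ (by positivity), mul_comm (Dir φ)]
    exact (H φ h).1
  · exact le_tor ho (hv.trans_lt measure_ball_lt_top).ne fun φ h => (H φ h).2

/-- splitting of test functions on a disconnected set -/
lemma split_test {n : ℕ} {A B : Set (Euc n)} (hA : IsOpen A) (hB : IsOpen B) (hd : Disjoint A B)
    {φ : Euc n → ℝ} (h : IsTestFun (A ∪ B) φ) : IsTestFun A (A.indicator φ) := by
  have hts : tsupport (A.indicator φ) ⊆ tsupport φ ∩ A := by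
    have h1 : tsupport φ ∩ A = tsupport φ ∩ Bᶜ := by
      ext x
      constructor
      · rintro ⟨h1, h2⟩
        exact ⟨h1, fun h3 => disjoint_left.1 hd h2 h3⟩
      · rintro ⟨h1, h2⟩
        exact ⟨h1, (h.2.2 h1).resolve_right h2⟩
    rw [h1]
    refine closure_minimal ?_ ((isClosed_tsupport φ).inter hB.isClosed_compl)
    rw [← h1]
    intro x hx
    rw [Function.mem_support] at hx
    have hxA : x ∈ A := by
      by_contra hc; exact hx (by simp [hc])
    rw [indicator_of_mem hxA] at hx
    exact ⟨subset_tsupport _ hx, hxA⟩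
  refine ⟨?_, ?_, fun x hx => (hts hx).2⟩
  · rw [contDiff_iff_contDiffAt]
    intro x
    by_cases hx : x ∈ A
    · refine h.1.contDiffAt.congr_of_eventuallyEq ?_
      filter_upwards [hA.mem_nhds hx] with y hy using indicator_of_mem hy _
    · have : x ∉ tsupport (A.indicator φ) := fun hh => hx (hts hh).2
      exact (contDiffAt_const (c := (0 : ℝ))).congr_of_eventuallyEq
        (notMem_tsupport_iff_eventuallyEq.1 this)
  · exact h.2.1.of_isClosed_subset (isClosed_tsupport _) (hts.trans inter_subset_left)

lemma fk_disc {n : ℕ} (hn : 2 ≤ n) {A B : Set (Euc n)} (hA : IsOpen A) (hB : IsOpen B)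
    (hd : Disjoint A B) (hne : (A ∪ B).Nonempty) {r : ℝ} (hr : 0 < r)
    (hvA : volume A ≤ volume (ball (0 : Euc n) r)) (hvB : volume B ≤ volume (ball (0 : Euc n) r)) :
    Lam n / r ^ 2 ≤ lam1 (A ∪ B) := by
  refine le_lam1 (hA.union hB) hne fun φ h => ?_
  rw [div_mul_eq_mul_div, div_le_iff₀ (by positivity), mul_comm (Dir φ)]
  have tA := split_test hA hB hd h
  have tB := split_test hB hA hd.symm (by rwa [union_comm])
  have f1 := (fk_test hn hr tA ((measure_mono (supp_sub tA)).trans hvA)).1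
  have f2 := (fk_test hn hr tB ((measure_mono (supp_sub tB)).trans hvB)).1
  have e : ∀ x, φ x = A.indicator φ x + B.indicator φ x := by
    intro x
    by_cases hx : x ∈ A
    · simp [hx, disjoint_left.1 hd hx]
    · by_cases hx' : x ∈ B
      · simp [hx, hx']
      · have : φ x = 0 := by
          by_contra hc
          exact (supp_sub h hc).elim hx hx'
        simp [hx, hx', this]
  have e0 : ∀ x, A.indicator φ x = 0 ∨ B.indicator φ x = 0 := by
    intro x
    by_cases hx : x ∈ A
    · right; simp [disjoint_left.1 hd hx]
    · left; simp [hx]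
  have e1 : ∫ x, φ x ^ 2 = (∫ x, A.indicator φ x ^ 2) + ∫ x, B.indicator φ x ^ 2 := by
    rw [← integral_add (test_int_sq tA) (test_int_sq tB)]
    congr 1; ext x
    rw [e x]
    rcases e0 x with h | h <;> simp [h]
  have e2 : Dir φ = Dir (A.indicator φ) + Dir (B.indicator φ) := by
    unfold Dir
    rw [← integral_add (int_fderiv tA.1 tA.2.1) (int_fderiv tB.1 tB.2.1)]
    congr 1; ext x
    have hdA : Differentiable ℝ (A.indicator φ) := tA.1.differentiable (by simp)
    have hdB : Differentiable ℝ (B.indicator φ) := tB.1.differentiable (by simp)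
    have e3 : fderiv ℝ φ x = fderiv ℝ (A.indicator φ) x + fderiv ℝ (B.indicator φ) x := by
      rw [← fderiv_add (hdA x) (hdB x)]
      congr 1; ext y; exact e y
    have e4 : fderiv ℝ (A.indicator φ) x = 0 ∨ fderiv ℝ (B.indicator φ) x = 0 := by
      by_cases hx : x ∈ A
      · right
        by_contra hc
        exact disjoint_left.1 hd hx (tB.2.2 (support_fderiv_subset ℝ hc))
      · left
        by_contra hc
        exact hx (tA.2.2 (support_fderiv_subset ℝ hc))
    rw [e3]
    rcases e4 with h | h <;> simp [h]
  rw [e1, e2]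
  linarith

lemma pow_diff_le {a b : ℝ} (ha : 0 ≤ a) (hab : a ≤ b) (k : ℕ) :
    b ^ (k + 1) - a ^ (k + 1) ≤ (k + 1) * b ^ k * (b - a) := by
  induction k with
  | zero => simp
  | succ k ih =>
    have hb : 0 ≤ b := ha.trans hab
    have h1 := mul_le_mul_of_nonneg_left ih hb
    have h2 : a ^ (k + 1) ≤ b ^ (k + 1) := pow_le_pow_left₀ ha hab _
    have h3 := mul_le_mul_of_nonneg_right h2 (sub_nonneg.2 hab)
    calc b ^ (k + 1 + 1) - a ^ (k + 1 + 1)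
        = b * (b ^ (k + 1) - a ^ (k + 1)) + a ^ (k + 1) * (b - a) := by ring
      _ ≤ b * ((k + 1) * b ^ k * (b - a)) + b ^ (k + 1) * (b - a) := add_le_add h1 h3
      _ = _ := by push_cast; ring

lemma pow_diff_ge {a b : ℝ} (ha : 0 ≤ a) (hab : a ≤ b) (k : ℕ) :
    a ^ k * (b - a) ≤ b ^ (k + 1) - a ^ (k + 1) := by
  have h2 : a ^ k ≤ b ^ k := pow_le_pow_left₀ ha hab _
  have h3 := mul_le_mul_of_nonneg_right h2 (ha.trans hab)
  rw [pow_succ, pow_succ]; linarith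

lemma gap1 {r ρ L T τ ω η : ℝ} {k : ℕ} (hr : 0 < r) (hrρ : r < ρ) (hL : 0 < L) (hT : T ≤ 0)
    (hτ : 0 ≤ τ) (hω : 0 < ω) (hη : 0 < η) (H : η * (ω * ((k + 1) * ρ ^ k)) < L / ρ ^ 3) :
    L / ρ ^ 2 + τ * (T * ρ ^ (k + 3)) <
      L / r ^ 2 + τ * (T * r ^ (k + 3)) + η * (r ^ (k + 1) * ω - ρ ^ (k + 1) * ω) := by
  have hρ : 0 < ρ := hr.trans hrρ
  have h1 : τ * (T * ρ ^ (k + 3)) ≤ τ * (T * r ^ (k + 3)) := by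
    refine mul_le_mul_of_nonneg_left ?_ hτ
    exact mul_le_mul_of_nonpos_left (pow_le_pow_left₀ hr.le hrρ.le _) hT
  have h2 := pow_diff_le hr.le hrρ.le k
  have h3 : η * ω * (ρ ^ (k + 1) - r ^ (k + 1)) ≤ η * ω * ((k + 1) * ρ ^ k * (ρ - r)) :=
    mul_le_mul_of_nonneg_left h2 (by positivity)
  have h4 : L / ρ ^ 3 * (ρ - r) ≤ L / r ^ 2 - L / ρ ^ 2 := by
    have : L / r ^ 2 - L / ρ ^ 2 - L / ρ ^ 3 * (ρ - r) =
        L * (ρ - r) * (ρ * (ρ + r) - r ^ 2) / (ρ ^ 3 * r ^ 2) := by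
      field_simp; ring
    have h5 : 0 ≤ ρ * (ρ + r) - r ^ 2 := by nlinarith
    have h6 : 0 ≤ L * (ρ - r) * (ρ * (ρ + r) - r ^ 2) / (ρ ^ 3 * r ^ 2) := by
      have := sub_nonneg.2 hrρ.le
      positivity
    linarith
  have h5 := mul_lt_mul_of_pos_right H (sub_pos.2 hrρ)
  nlinarith

lemma gap2 {r ρ R L T τ ω η : ℝ} {k : ℕ} (hρ : 0 < ρ) (hrρ : ρ < r) (hrR : r ≤ R) (hL : 0 < L)
    (hT : T ≤ 0) (hτ : 0 ≤ τ) (hτ1 : τ ≤ 1) (hω : 0 < ω) (hη : 0 < η)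
    (H : η * (2 * L / ρ ^ 3 + -T * (((k + 2 : ℕ) + 1) * R ^ (k + 2))) < ω * ρ ^ k) :
    L / ρ ^ 2 + τ * (T * ρ ^ (k + 3)) <
      L / r ^ 2 + τ * (T * r ^ (k + 3)) + (r ^ (k + 1) * ω - ρ ^ (k + 1) * ω) / η := by
  have hr : 0 < r := hρ.trans hrρ
  have hd : 0 < r - ρ := sub_pos.2 hrρ
  have hT' : 0 ≤ -T := by linarith
  have h1 : r ^ (k + 3) - ρ ^ (k + 3) ≤ ((k + 2 : ℕ) + 1) * R ^ (k + 2) * (r - ρ) := by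
    refine (pow_diff_le hρ.le hrρ.le (k + 2)).trans ?_
    have : r ^ (k + 2) ≤ R ^ (k + 2) := pow_le_pow_left₀ hr.le hrR _
    gcongr
  have h0 : 0 ≤ r ^ (k + 3) - ρ ^ (k + 3) := sub_nonneg.2 (pow_le_pow_left₀ hρ.le hrρ.le _)
  have h2 : τ * (-T * (r ^ (k + 3) - ρ ^ (k + 3))) ≤ -T * (((k + 2 : ℕ) + 1) * R ^ (k + 2) * (r - ρ)) := by
    calc _ ≤ 1 * (-T * (r ^ (k + 3) - ρ ^ (k + 3))) :=
          mul_le_mul_of_nonneg_right hτ1 (mul_nonneg hT' h0)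
      _ ≤ _ := by rw [one_mul]; exact mul_le_mul_of_nonneg_left h1 hT'
  have h3 := pow_diff_ge hρ.le hrρ.le k
  have h4 : L / ρ ^ 2 - L / r ^ 2 ≤ 2 * L / ρ ^ 3 * (r - ρ) := by
    have : 2 * L / ρ ^ 3 * (r - ρ) - (L / ρ ^ 2 - L / r ^ 2) =
        L * (r - ρ) * (2 * r ^ 2 - ρ * (r + ρ)) / (ρ ^ 3 * r ^ 2) := by
      field_simp; ring
    have h5 : 0 ≤ 2 * r ^ 2 - ρ * (r + ρ) := by nlinarith
    have h6 : 0 ≤ L * (r - ρ) * (2 * r ^ 2 - ρ * (r + ρ)) / (ρ ^ 3 * r ^ 2) := by positivity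
    linarith
  have h5 : (2 * L / ρ ^ 3 + -T * (((k + 2 : ℕ) + 1) * R ^ (k + 2))) * (r - ρ) <
      (r ^ (k + 1) * ω - ρ ^ (k + 1) * ω) / η := by
    rw [lt_div_iff₀ hη]
    have h6 := mul_lt_mul_of_pos_right H hd
    have h7 := mul_le_mul_of_nonneg_left h3 hω.le
    nlinarith
  nlinarith

lemma main_aux (n : ℕ) (hn : 2 ≤ n) (R v vmax : ℝ)
    (hR : 0 < R) (hv : 0 < v) (hvv : v < vmax)
    (hvmax : vmax < (volume (ball (0 : Euc n) R)).toReal) :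
    ∃ η₀ : ℝ, 0 < η₀ ∧ ∀ η : ℝ, 0 < η → η ≤ η₀ →
      ∃ 𝔗₀ : ℝ, 0 < 𝔗₀ ∧ ∀ 𝔗 : ℝ, 0 < 𝔗 → 𝔗 ≤ 𝔗₀ →
        BddBelow (baseE v η 𝔗 '' Hclass n R vmax) ∧
        (∃ Ω ∈ Hclass n R vmax, ∀ Ω' ∈ Hclass n R vmax,
          baseE v η 𝔗 Ω ≤ baseE v η 𝔗 Ω') ∧
        ∀ Ω ∈ Hclass n R vmax,
          (∀ Ω' ∈ Hclass n R vmax, baseE v η 𝔗 Ω ≤ baseE v η 𝔗 Ω') →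
          IsConnected Ω ∧ (volume Ω).toReal = v := by
  have hnt := nontriv hn
  obtain ⟨k, rfl⟩ : ∃ k, n = k + 1 := ⟨n - 1, by omega⟩
  set n := k + 1 with hnk
  set ω := (volume (ball (0 : Euc n) 1)).toReal with hωd
  have hω : 0 < ω := ENNReal.toReal_pos (measure_ball_pos _ _ one_pos).ne' measure_ball_lt_top.ne
  have hvol : ∀ r : ℝ, 0 ≤ r → (volume (ball (0 : Euc n) r)).toReal = r ^ (k + 1) * ω := by
    intro r hr
    rw [vol_ball hn hr, ENNReal.toReal_mul, ENNReal.toReal_ofReal (by positivity)]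
  obtain ⟨ρ, hρ0, hρv⟩ := exists_radius hn (m := ENNReal.ofReal v) ENNReal.ofReal_ne_top
  have hρv' : (volume (ball (0 : Euc n) ρ)).toReal = v := by
    rw [hρv, ENNReal.toReal_ofReal hv.le]
  have hρ : 0 < ρ := by
    rcases hρ0.eq_or_lt with h | h
    · rw [← h] at hρv'; simp at hρv'; linarith
    · exact h
  have hvρ : v = ρ ^ (k + 1) * ω := by rw [← hρv', hvol ρ hρ0]
  have hρR : ρ < R := by
    rw [← vol_ball_lt hn hρ0 hR.le, ← ENNReal.toReal_lt_toReal measure_ball_lt_top.ne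
      measure_ball_lt_top.ne, hρv']
    linarith
  have hL := Lam_pos hn
  have hT := Tor0_nonpos hn
  set L := Lam n
  set T := Tor0 n
  set a := L / ρ ^ 3 / (ω * ((k + 1) * ρ ^ k)) with ha
  set Q := 2 * L / ρ ^ 3 + -T * (((k + 2 : ℕ) + 1) * R ^ (k + 2)) with hQ
  have hQp : 0 < Q := by
    have : 0 ≤ -T := by linarith
    have h2 : 0 ≤ -T * (((k + 2 : ℕ) + 1) * R ^ (k + 2)) := by positivity
    have : 0 < 2 * L / ρ ^ 3 := by positivity
    linarith
  have hap : 0 < a := by positivity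
  refine ⟨min (a / 2) (ω * ρ ^ k / Q / 2), lt_min (by positivity) (by positivity), fun η hη hη0 =>
    ⟨1, one_pos, fun τ hτ hτ1 => ?_⟩⟩
  have H1 : η * (ω * ((k + 1) * ρ ^ k)) < L / ρ ^ 3 := by
    rw [← lt_div_iff₀ (by positivity)]
    have := hη0.trans (min_le_left _ _)
    linarith
  have H2 : η * Q < ω * ρ ^ k := by
    rw [← lt_div_iff₀ hQp]
    have := hη0.trans (min_le_right _ _)
    have : 0 < ω * ρ ^ k / Q := by positivity
    linarith
  set E := L / ρ ^ 2 + τ * (T * ρ ^ (k + 3)) with hE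
  have hball : baseE v η τ (ball (0 : Euc n) ρ) ≤ E := by
    unfold baseE
    rw [hρv']
    have h1 := lam1_ball (n := n) hρ
    have h2 := mul_le_mul_of_nonneg_left (tor_ball hn hρ) hτ.le
    have h3 : fpen v η v = 0 := by simp [fpen]
    rw [h3]
    have h4 : L / ρ ^ 2 + τ * (T * ρ ^ (n + 2)) = E := rfl
    linarith
  have hmem : ball (0 : Euc n) ρ ∈ Hclass n R vmax :=
    ⟨isOpen_ball, ⟨0, by simpa using hρ⟩, ball_subset_ball hρR.le, by rw [hρv']; exact hvv.le⟩
  have hlow : ∀ Ω ∈ Hclass n R vmax, E ≤ baseE v η τ Ω ∧ ((volume Ω).toReal ≠ v → E < baseE v η τ Ω) := by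
    rintro Ω ⟨ho, hne, hsub, -⟩
    have hfin : volume Ω ≠ ⊤ := ((measure_mono hsub).trans_lt measure_ball_lt_top).ne
    obtain ⟨r, hr0, hrv⟩ := exists_radius hn hfin
    have hpos := ho.measure_pos volume hne
    have hr : 0 < r := by
      rcases hr0.eq_or_lt with h | h
      · rw [← h] at hrv; simp at hrv; exact absurd hrv.symm hpos.ne'
      · exact h
    have hrR : r ≤ R := by
      by_contra hc
      have := (vol_ball_lt hn hR.le hr0).2 (not_le.1 hc)
      rw [hrv] at this
      exact absurd (measure_mono hsub) (not_le.2 this)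
    obtain ⟨f1, f2⟩ := fk hn ho hne hr hrv.ge
    have f3 := mul_le_mul_of_nonneg_left f2 hτ.le
    have ht : (volume Ω).toReal = r ^ (k + 1) * ω := by rw [← hrv, hvol r hr0]
    have f4 : L / r ^ 2 + τ * (T * r ^ (k + 3)) + fpen v η (r ^ (k + 1) * ω) ≤ baseE v η τ Ω := by
      unfold baseE
      rw [ht]
      have : τ * (T * r ^ (k + 3)) ≤ τ * tor Ω := f3
      linarith
    rcases lt_trichotomy r ρ with h | h | h
    · have g := gap1 hr h hL hT hτ.le hω hη H1
      have hlt : r ^ (k + 1) * ω ≤ v := by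
        rw [hvρ]; exact mul_le_mul_of_nonneg_right (pow_le_pow_left₀ hr0 h.le _) hω.le
      rw [fpen, if_pos hlt, hvρ] at f4
      rw [← hvρ] at f4 g
      have := g.trans_le f4
      exact ⟨this.le, fun _ => this⟩
    · subst h
      rw [← hvρ] at f4 ht
      have h3 : fpen v η v = 0 := by simp [fpen]
      rw [h3, add_zero] at f4
      exact ⟨f4, fun h => absurd ht h⟩
    · have g := gap2 hρ h hrR hL hT hτ.le hτ1 hω hη H2
      have hlt : ¬ r ^ (k + 1) * ω ≤ v := by
        rw [hvρ, not_le]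
        exact mul_lt_mul_of_pos_right (pow_lt_pow_left₀ h hρ0 (by omega)) hω
      rw [fpen, if_neg hlt] at f4
      rw [← hvρ] at g
      have := g.trans_le f4
      exact ⟨this.le, fun _ => this⟩
  refine ⟨⟨E, ?_⟩, ⟨_, hmem, fun Ω' h' => hball.trans (hlow Ω' h').1⟩, ?_⟩
  · rintro _ ⟨Ω, hΩ, rfl⟩
    exact (hlow Ω hΩ).1
  · intro Ω hΩ hmin
    have hle : baseE v η τ Ω ≤ E := (hmin _ hmem).trans hball
    have hvΩ : (volume Ω).toReal = v := by
      by_contra hc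
      exact absurd ((hlow Ω hΩ).2 hc) (not_lt.2 hle)
    refine ⟨⟨hΩ.2.1, ?_⟩, hvΩ⟩
    obtain ⟨ho, hne, hsub, -⟩ := hΩ
    have hfin : volume Ω ≠ ⊤ := ((measure_mono hsub).trans_lt measure_ball_lt_top).ne
    have hvΩ' : volume Ω = volume (ball (0 : Euc n) ρ) :=
      (ENNReal.toReal_eq_toReal_iff' hfin measure_ball_lt_top.ne).1 (by rw [hvΩ, hρv'])
    intro U V hU hV hUV hΩU hΩV
    by_contra hcon
    rw [not_nonempty_iff_eq_empty] at hcon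
    set A := Ω ∩ U
    set B := Ω ∩ V
    have hA : IsOpen A := ho.inter hU
    have hB : IsOpen B := ho.inter hV
    have hAB : A ∪ B = Ω := by rw [← inter_union_distrib_left, inter_eq_left.2 hUV]
    have hd : Disjoint A B := by
      rw [disjoint_iff_inter_eq_empty, ← hcon]
      ext x; simp only [A, B, mem_inter_iff]; tauto
    have hpA := hA.measure_pos volume hΩU
    have hpB := hB.measure_pos volume hΩV
    have hsum : volume A + volume B = volume Ω := by
      rw [← hAB, measure_union hd hB.measurableSet]
    have hAf : volume A ≠ ⊤ := ((measure_mono inter_subset_left).trans_lt hfin.lt_top).ne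
    have hBf : volume B ≠ ⊤ := ((measure_mono inter_subset_left).trans_lt hfin.lt_top).ne
    have hmx : max (volume A) (volume B) < volume Ω := by
      rw [← hsum]
      exact max_lt (ENNReal.lt_add_right hAf hpB.ne')
        (by rw [add_comm]; exact ENNReal.lt_add_right hBf hpA.ne')
    obtain ⟨q, hq0, hqv⟩ := exists_radius hn (hmx.trans hfin.lt_top).ne
    have hq : 0 < q := by
      rcases hq0.eq_or_lt with h | h
      · rw [← h] at hqv; simp at hqv
        exact absurd (hpA.trans_le (le_max_left _ (volume B))) (by rw [← hqv]; exact lt_irrefl _)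
      · exact h
    have hqρ : q < ρ := by
      rw [← vol_ball_lt hn hq0 hρ0, hqv, ← hvΩ']; exact hmx
    have f1 := fk_disc hn hA hB hd (by rw [hAB]; exact hne) hq
      (by rw [hqv]; exact le_max_left _ _) (by rw [hqv]; exact le_max_right _ _)
    rw [hAB] at f1
    have f2 := mul_le_mul_of_nonneg_left (fk hn ho hne hρ hvΩ'.le).2 hτ.le
    have f3 : L / ρ ^ 2 < L / q ^ 2 :=
      div_lt_div_of_pos_left hL (by positivity) (pow_lt_pow_left₀ hqρ hq0 (by norm_num))
    unfold baseE at hle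
    rw [hvΩ] at hle
    have h3 : fpen v η v = 0 := by simp [fpen]
    rw [h3] at hle
    have f2' : τ * (T * ρ ^ (k + 3)) ≤ τ * tor Ω := f2
    linarith

/-- **Existence and structure of minimizers of the penalized base energy.** For
`n ≥ 2`, `R > 0`, `0 < v < v_max < |B_R(0)|`, for `η` small and then `𝔗` small, the
base energy is bounded below on `𝓗`, attains its infimum, and every minimizer is
connected with volume exactly `v`. -/
theorem base_energy_minimizers (n : ℕ) (hn : 2 ≤ n) (R v vmax : ℝ)
    (hR : 0 < R) (hv : 0 < v) (hvv : v < vmax)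
    (hvmax : vmax < (volume (ball (0 : Euc n) R)).toReal) :
    ∃ η₀ : ℝ, 0 < η₀ ∧ ∀ η : ℝ, 0 < η → η ≤ η₀ →
      ∃ 𝔗₀ : ℝ, 0 < 𝔗₀ ∧ ∀ 𝔗 : ℝ, 0 < 𝔗 → 𝔗 ≤ 𝔗₀ →
        BddBelow (baseE v η 𝔗 '' Hclass n R vmax) ∧
        (∃ Ω ∈ Hclass n R vmax, ∀ Ω' ∈ Hclass n R vmax,
          baseE v η 𝔗 Ω ≤ baseE v η 𝔗 Ω') ∧
        ∀ Ω ∈ Hclass n R vmax,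
          (∀ Ω' ∈ Hclass n R vmax, baseE v η 𝔗 Ω ≤ baseE v η 𝔗 Ω') →
          IsConnected Ω ∧ (volume Ω).toReal = v := by
  exact main_aux n hn R v vmax hR hv hvv hvmax
end
end

section
/- Mean value-type inequality controlled by the mass of the Laplacian: For every n ≥ 3 there is a constant C(n) such that for every x ∈ ℝ^n, every r > 0, and every nonnegative function φ that is smooth on a neighborhood of the closed ball of radius r about x, one has (1/r^{n−1}) · ∫_{∂B_r(x)} φ dℋ^{n−1} ≤ C(n) · [ φ(x) + ∫₀^r s^{1−n} · ( ∫_{B_s(x)} |Δφ(y)| dy ) ds ], where ℋ^{n−1} is (n−1)-dimensional Hausdorff measure on the sphere ∂B_r(x) and Δφ is the Laplacian of φ. -/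
open MeasureTheory Metric Set
open scoped ENNReal Topology

noncomputable section

/-- The Euclidean Laplacian `Δφ = Σᵢ ∂²φ/∂xᵢ²`. -/
def lap {n : ℕ} (φ : Euc n → ℝ) (x : Euc n) : ℝ :=
  ∑ i : Fin n, fderiv ℝ (fun y => fderiv ℝ φ y (EuclideanSpace.single i 1)) x
    (EuclideanSpace.single i 1)

lemma unif_swap {X : Type*} [MetricSpace X] [SecondCountableTopology X] [MeasurableSpace X]
    [BorelSpace X] (μ ν : Measure X) [IsFiniteMeasure μ] [IsFiniteMeasure ν] (ρ : ℝ) (U : Set X) :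
    ∫⁻ x in U, ν.restrict U (ball x ρ) ∂μ = ∫⁻ x in U, μ.restrict U (ball x ρ) ∂ν := by
  have hD : MeasurableSet {p : X × X | dist p.1 p.2 < ρ} :=
    (isOpen_lt (by fun_prop) (by fun_prop)).measurableSet
  have h1 := Measure.prod_apply (μ := μ.restrict U) (ν := ν.restrict U) hD
  have h2 := Measure.prod_apply_symm (μ := μ.restrict U) (ν := ν.restrict U) hD
  rw [h1] at h2
  convert h2 using 3 with x y
  · congr 1; ext y; simp [dist_comm]
  · rfl

lemma unif {X : Type*} [MetricSpace X] [SecondCountableTopology X] [MeasurableSpace X]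
    [BorelSpace X] [Nonempty X] (μ ν : Measure X) [IsFiniteMeasure μ] [IsFiniteMeasure ν]
    [ν.IsOpenPosMeasure]
    (hμ : ∀ ρ x y, μ (ball x ρ) = μ (ball y ρ)) (hν : ∀ ρ x y, ν (ball x ρ) = ν (ball y ρ)) :
    ∃ K : NNReal, μ ≤ K • ν := by
  obtain ⟨x₀⟩ := ‹Nonempty X›
  have : Nonempty X := ⟨x₀⟩
  have hν0 : ν univ ≠ 0 := isOpen_univ.measure_ne_zero _ univ_nonempty
  have hK : μ univ / ν univ ≠ ∞ := ENNReal.div_ne_top (by simp) hν0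
  refine ⟨(μ univ / ν univ).toNNReal, ?_⟩
  set K := μ univ / ν univ with hKdef
  have hball : ∀ ρ, μ (ball x₀ ρ) = K * ν (ball x₀ ρ) := by
    intro ρ
    have h := unif_swap μ ν ρ univ
    simp only [Measure.restrict_univ] at h
    rw [lintegral_congr (fun x => hν ρ x x₀), lintegral_congr (fun x => hμ ρ x x₀)] at h
    simp only [lintegral_const] at h
    rw [hKdef, ENNReal.div_eq_inv_mul, mul_assoc, mul_comm (μ univ), h, mul_comm (μ _), ← mul_assoc,
      ENNReal.inv_mul_cancel hν0 (by simp), one_mul]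
  have hopen : ∀ U : Set X, IsOpen U → μ U ≤ K * ν U := by
    intro U hU
    let ρ : ℕ → ℝ := fun k => 1 / ((k : ℝ) + 1)
    have hρ : ∀ k, 0 < ρ k := fun k => by positivity
    have hg : ∀ k, ν (ball x₀ (ρ k)) ≠ 0 := fun k =>
      isOpen_ball.measure_ne_zero _ ⟨x₀, mem_ball_self (hρ k)⟩
    let F : ℕ → X → ℝ≥0∞ := fun k x => (ν (ball x₀ (ρ k)))⁻¹ * ν.restrict U (ball x (ρ k))
    have hmeas : ∀ k, Measurable (F k) := by
      intro k
      refine Measurable.const_mul ?_ _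
      have hD : MeasurableSet {p : X × X | dist p.2 p.1 < ρ k} :=
        (isOpen_lt (by fun_prop) (by fun_prop)).measurableSet
      exact measurable_measure_prodMk_left hD
    have hfat := lintegral_liminf_le (μ := μ.restrict U) (u := Filter.atTop) hmeas
    have h1 : μ U ≤ ∫⁻ a in U, Filter.liminf (fun i => F i a) Filter.atTop ∂μ := by
      rw [← setLIntegral_one U]
      refine setLIntegral_mono' hU.measurableSet ?_
      intro x hx
      obtain ⟨ε, hε, hεU⟩ := Metric.isOpen_iff.1 hU x hx
      have hev : ∀ᶠ k in Filter.atTop, F k x = 1 := by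
        have ht : Filter.Tendsto ρ Filter.atTop (𝓝 0) := tendsto_one_div_add_atTop_nhds_zero_nat
        filter_upwards [ht.eventually (gt_mem_nhds hε)] with k hk
        simp only [F]
        rw [Measure.restrict_apply measurableSet_ball,
          inter_eq_left.2 ((ball_subset_ball hk.le).trans hεU), hν _ x x₀,
          ENNReal.inv_mul_cancel (hg k) (by simp)]
      exact le_of_eq (Filter.Tendsto.liminf_eq (tendsto_const_nhds.congr' (hev.mono fun k hk => hk.symm))).symm
    refine h1.trans (hfat.trans ?_)
    have h2 : ∀ k, ∫⁻ a in U, F k a ∂μ ≤ K * ν U := by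
      intro k
      simp only [F]
      rw [lintegral_const_mul' _ _ (by simpa using hg k), unif_swap]
      calc _ ≤ (ν (ball x₀ (ρ k)))⁻¹ * ∫⁻ x in U, K * ν (ball x₀ (ρ k)) ∂ν := by
            gcongr with x
            rw [← hball, ← hμ _ x x₀]
            exact Measure.restrict_apply_le _ _
        _ = _ := by
            rw [setLIntegral_const, mul_comm K, mul_assoc, ← mul_assoc,
              ENNReal.inv_mul_cancel (hg k) (by simp), one_mul]
    calc _ ≤ Filter.liminf (fun _ : ℕ => K * ν U) Filter.atTop :=
          Filter.liminf_le_liminf (Filter.Eventually.of_forall h2)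
      _ = _ := by simp
  rw [Measure.le_iff]
  intro s hs
  have : ((K.toNNReal • ν) : Measure X) s = K * ν s := by
    rw [Measure.smul_apply, ENNReal.smul_def, ENNReal.coe_toNNReal hK, smul_eq_mul]
  rw [this]
  have hreg : ν s = ⨅ (U : Set X) (_ : s ⊆ U) (_ : IsOpen U), ν U := s.measure_eq_iInf_isOpen ν
  by_cases hK0 : K = 0
  · have := hopen univ isOpen_univ
    rw [hK0] at this ⊢
    simp only [zero_mul] at this ⊢
    exact (measure_mono (subset_univ s)).trans this
  rw [hreg]
  rw [mul_comm, ← ENNReal.div_le_iff_le_mul (Or.inl hK0) (Or.inl hK)]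
  refine le_iInf fun U => le_iInf fun hsU => le_iInf fun hU => ?_
  rw [ENNReal.div_le_iff_le_mul (Or.inl hK0) (Or.inl hK), mul_comm]
  exact (measure_mono hsU).trans (hopen U hU)

lemma normalize_lip {m : ℕ} :
    LipschitzOnWith 2 (fun x : Euc m => ‖x‖⁻¹ • x) {x | 1 ≤ ‖x‖} := by
  refine LipschitzOnWith.of_dist_le_mul ?_
  intro x hx y hy
  simp only [mem_ofPred_eq] at hx hy
  have hx0 : 0 < ‖x‖ := by linarith
  have hy0 : 0 < ‖y‖ := by linarith
  rw [dist_eq_norm, dist_eq_norm]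
  have : ‖x‖⁻¹ • x - ‖y‖⁻¹ • y = ‖x‖⁻¹ • ((x - y) + ((‖y‖ - ‖x‖) * ‖y‖⁻¹) • y) := by
    have e : (‖y‖ - ‖x‖) * ‖y‖⁻¹ = 1 - ‖x‖ * ‖y‖⁻¹ := by field_simp
    rw [e, sub_smul, one_smul, sub_add_sub_cancel, smul_sub, smul_smul, ← mul_assoc,
      inv_mul_cancel₀ hx0.ne', one_mul]
  rw [this, norm_smul, norm_inv, norm_norm]
  have h1 : ‖(x - y) + ((‖y‖ - ‖x‖) * ‖y‖⁻¹) • y‖ ≤ 2 * ‖x - y‖ := by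
    refine (norm_add_le _ _).trans ?_
    rw [norm_smul, norm_mul, norm_inv, norm_norm, mul_assoc, inv_mul_cancel₀ hy0.ne', mul_one]
    have := abs_norm_sub_norm_le y x
    rw [norm_sub_rev] at this
    rw [Real.norm_eq_abs]
    linarith
  calc _ ≤ 1 * (2 * ‖x - y‖) := by
        gcongr
        exact inv_le_one_of_one_le₀ hx
    _ = _ := by simp

lemma sphere_finite (m : ℕ) : (μH[(m : ℝ)] : Measure (Euc (m + 1))) (sphere 0 1) < ∞ := by
  let F : Fin (m+1) → ℝ → (Fin m → ℝ) → Euc (m+1) := fun i e u => WithLp.toLp 2 (Fin.insertNth i e u)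
  have hnorm : ∀ i e u, |e| = 1 → 1 ≤ ‖F i e u‖ := by
    intro i e u he
    have := PiLp.norm_apply_le (F i e u) i
    simpa [F, he] using this
  obtain ⟨L, hL⟩ : ∃ L : NNReal, ∀ i e, LipschitzWith L (F i e) := by
    refine ⟨_, fun i e => (PiLp.lipschitzWith_toLp 2 (fun _ : Fin (m+1) => ℝ)).comp
      (Kg := 1) (LipschitzWith.of_dist_le_mul ?_)⟩
    intro u v
    simp only [NNReal.coe_one, one_mul]
    rw [dist_pi_le_iff dist_nonneg]
    intro j
    refine Fin.succAboveCases i ?_ ?_ j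
    · simp
    · intro k; simpa using dist_le_pi_dist u v k
  have hlip : ∀ i e, |e| = 1 → LipschitzOnWith (2 * L) (fun u => ‖F i e u‖⁻¹ • F i e u)
      (closedBall 0 1) := by
    intro i e he
    exact normalize_lip.comp (hL i e).lipschitzOnWith (fun u _ => hnorm i e u he)
  have hfin : ∀ i e, |e| = 1 →
      (μH[(m : ℝ)] : Measure (Euc (m + 1))) ((fun u => ‖F i e u‖⁻¹ • F i e u) '' closedBall 0 1) < ∞ := by
    intro i e he
    refine ((hlip i e he).hausdorffMeasure_image_le (by positivity)).trans_lt ?_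
    refine ENNReal.mul_lt_top (ENNReal.rpow_lt_top_of_nonneg (by positivity) ENNReal.coe_ne_top) ?_
    have := hausdorffMeasure_pi_real (ι := Fin m)
    rw [Fintype.card_fin] at this
    rw [this]
    exact measure_closedBall_lt_top
  have hcov : sphere (0 : Euc (m+1)) 1 ⊆ ⋃ i : Fin (m+1), 
      ((fun u => ‖F i 1 u‖⁻¹ • F i 1 u) '' closedBall 0 1) ∪
      ((fun u => ‖F i (-1) u‖⁻¹ • F i (-1) u) '' closedBall 0 1) := by
    intro w hw
    have hw1 : ‖w‖ = 1 := by simpa using hw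
    obtain ⟨i, -, hi⟩ := Finset.exists_max_image Finset.univ (fun i => |w i|) Finset.univ_nonempty
    have hwi : 0 < |w i| := by
      by_contra hcon
      have : w = 0 := by
        ext j
        have := hi j (Finset.mem_univ _)
        have : |w j| ≤ 0 := by linarith
        simpa using this
      simp [this] at hw1
    have key : ∀ e : ℝ, |e| = 1 → e * |w i| = w i → 
        w ∈ ((fun u => ‖F i e u‖⁻¹ • F i e u) '' closedBall 0 1) := by
      intro e he hew
      refine ⟨fun k => |w i|⁻¹ * w (i.succAbove k), ?_, ?_⟩
      · rw [mem_closedBall_zero_iff, pi_norm_le_iff_of_nonneg zero_le_one]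
        intro k
        rw [norm_mul, norm_inv, Real.norm_eq_abs, Real.norm_eq_abs, abs_abs, inv_mul_le_iff₀ hwi, mul_one]
        exact hi _ (Finset.mem_univ _)
      · have : F i e (fun k => |w i|⁻¹ * w (i.succAbove k)) = |w i|⁻¹ • w := by
          ext j
          refine Fin.succAboveCases i ?_ ?_ j
          · simp only [F, Fin.insertNth_apply_same, PiLp.smul_apply, smul_eq_mul]
            rw [← hew, abs_mul, he, abs_abs]; field_simp
          · intro k; simp [F]
        simp only [this, norm_smul, hw1, norm_inv, Real.norm_eq_abs, abs_abs, mul_one, inv_inv, smul_smul]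
        rw [mul_inv_cancel₀ hwi.ne', one_smul]
    refine mem_iUnion.2 ⟨i, ?_⟩
    rcases le_total 0 (w i) with h | h
    · left; exact key 1 (by simp) (by rw [abs_of_nonneg h]; simp)
    · right; exact key (-1) (by simp) (by rw [abs_of_nonpos h]; simp)
  refine (measure_mono hcov).trans_lt ((measure_iUnion_le _).trans_lt ?_)
  rw [tsum_fintype]
  refine ENNReal.sum_lt_top.2 fun i _ => (measure_union_le _ _).trans_lt ?_
  exact ENNReal.add_lt_top.2 ⟨hfin i 1 (by simp), hfin i (-1) (by simp)⟩

def sphIso {m : ℕ} (R : Euc m ≃ₗᵢ[ℝ] Euc m) : sphere (0 : Euc m) 1 ≃ᵢ sphere (0 : Euc m) 1 where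
  toFun w := ⟨R w, by simp⟩
  invFun w := ⟨R.symm w, by simp⟩
  left_inv w := by simp
  right_inv w := by simp
  isometry_toFun := by
    intro a b
    exact R.isometry a b

open scoped Pointwise in
lemma toSphere_iso {m : ℕ} (R : Euc m ≃ₗᵢ[ℝ] Euc m) (s : Set (sphere (0 : Euc m) 1))
    (hs : MeasurableSet s) :
    (volume : Measure (Euc m)).toSphere (sphIso R '' s) = (volume : Measure (Euc m)).toSphere s := by
  have hs' : MeasurableSet (sphIso R '' s) :=
    (sphIso R).toHomeomorph.measurableEmbedding.measurableSet_image.2 hs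
  rw [Measure.toSphere_apply' _ hs, Measure.toSphere_apply' _ hs']
  congr 1
  have : Ioo (0 : ℝ) 1 • ((↑) '' (sphIso R '' s) : Set (Euc m)) = R '' (Ioo (0 : ℝ) 1 • ((↑) '' s)) := by
    ext y
    simp only [mem_smul, mem_image, exists_exists_and_eq_and]
    constructor
    · rintro ⟨t, ht, w, hw, rfl⟩
      exact ⟨t • (w : Euc m), ⟨t, ht, w, hw, rfl⟩, R.map_smul t (w : Euc m)⟩
    · rintro ⟨_, ⟨t, ht, w, hw, rfl⟩, rfl⟩
      exact ⟨t, ht, w, hw, (R.map_smul t (w : Euc m)).symm⟩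
  rw [this]
  have h := R.measurePreserving.measure_preimage_equiv (f := R.toMeasurableEquiv) (R '' (Ioo (0 : ℝ) 1 • ((↑) '' s)))
  rw [← h]
  congr 1
  exact preimage_image_eq _ R.injective

lemma ball_iso {m : ℕ} (R : Euc m ≃ₗᵢ[ℝ] Euc m) (x) (ρ : ℝ) :
    sphIso R '' ball x ρ = ball (sphIso R x) ρ := (sphIso R).image_ball x ρ

lemma sph_trans {m : ℕ} (x y : sphere (0 : Euc m) 1) : ∃ R : Euc m ≃ₗᵢ[ℝ] Euc m, sphIso R x = y := by
  refine ⟨(Submodule.span ℝ {(x : Euc m) - y})ᗮ.reflection, ?_⟩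
  apply Subtype.ext
  have := Submodule.reflection_sub (v := (x : Euc m)) (w := y) (by simp)
  exact this

lemma haus_le (m : ℕ) : ∃ K : NNReal, 
    (μH[(m : ℝ)] : Measure (sphere (0 : Euc (m+1)) 1)) ≤ K • (volume : Measure (Euc (m+1))).toSphere := by
  have : IsFiniteMeasure (μH[(m : ℝ)] : Measure (sphere (0 : Euc (m+1)) 1)) := by
    refine ⟨?_⟩
    rw [← (isometry_subtype_coe (s := sphere (0 : Euc (m+1)) 1)).hausdorffMeasure_image (Or.inl (by positivity))]
    rw [image_univ, Subtype.range_coe]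
    exact sphere_finite m
  have : Nonempty (sphere (0 : Euc (m+1)) 1) := (NormedSpace.sphere_nonempty.2 zero_le_one).to_subtype
  refine unif _ _ ?_ ?_
  · intro ρ x y
    obtain ⟨R, rfl⟩ := sph_trans x y
    rw [← ball_iso, IsometryEquiv.hausdorffMeasure_image]
  · intro ρ x y
    obtain ⟨R, rfl⟩ := sph_trans x y
    rw [← ball_iso, toSphere_iso _ _ measurableSet_ball]

lemma haus_sphere (m : ℕ) : ∃ K : ℝ, 0 < K ∧ ∀ (x : Euc (m+1)) (r : ℝ), 0 < r → 
    ∀ φ : Euc (m+1) → ℝ, Continuous φ → (∀ y ∈ sphere x r, 0 ≤ φ y) →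
    ∫ y in sphere x r, φ y ∂(μH[(m : ℝ)]) ≤ r ^ m * (K * ∫ w, φ (x + r • (w : Euc (m+1)))
      ∂(volume : Measure (Euc (m+1))).toSphere) := by
  obtain ⟨K, hK⟩ := haus_le m
  refine ⟨K + 1, by positivity, ?_⟩
  intro x r hr φ hφ hpos
  set σ := (volume : Measure (Euc (m+1))).toSphere
  let g : sphere (0 : Euc (m+1)) 1 → Euc (m+1) := fun w => x + r • (w : Euc (m+1))
  have hg : Continuous g := by fun_prop
  have hgl : LipschitzWith r.toNNReal g := by
    refine LipschitzWith.of_dist_le_mul fun a b => ?_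
    simp only [g, dist_add_left, dist_smul₀, Real.norm_eq_abs, abs_of_pos hr, Real.coe_toNNReal _ hr.le]
    rfl
  have hgs : ∀ w, g w ∈ sphere x r := by
    intro w
    simp [g, norm_smul, abs_of_pos hr]
  have hle : (μH[(m : ℝ)] : Measure (Euc (m+1))).restrict (sphere x r) ≤
      (r.toNNReal ^ m * (K + 1)) • σ.map g := by
    rw [Measure.le_iff]
    intro s hs
    rw [Measure.restrict_apply hs]
    have h1 : s ∩ sphere x r ⊆ g '' (g ⁻¹' s) := by
      rintro y ⟨hy, hyr⟩
      have hyr' : ‖y - x‖ = r := by simpa [dist_eq_norm] using hyr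
      refine ⟨⟨r⁻¹ • (y - x), ?_⟩, ?_⟩
      · simp [norm_smul, hyr', abs_of_pos hr, hr.ne']
      · have : g ⟨r⁻¹ • (y - x), by simp [norm_smul, hyr', abs_of_pos hr, hr.ne']⟩ = y := by
          simp [g, smul_smul, hr.ne']
        exact ⟨by rw [mem_preimage, this]; exact hy, this⟩
    refine (measure_mono h1).trans ((hgl.hausdorffMeasure_image_le (by positivity) _).trans ?_)
    rw [Measure.smul_apply, Measure.map_apply hg.measurable hs, ENNReal.rpow_natCast, ENNReal.smul_def,
      ENNReal.coe_mul, ENNReal.coe_pow, smul_eq_mul, mul_assoc]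
    gcongr
    refine (hK _).trans ?_
    rw [Measure.smul_apply, ENNReal.smul_def, smul_eq_mul]
    gcongr
    simp
  have hint : Integrable φ (σ.map g) := by
    rw [integrable_map_measure hφ.aestronglyMeasurable hg.aemeasurable]
    exact (hφ.comp hg).integrable_of_hasCompactSupport (HasCompactSupport.of_compactSpace _)
  have hpos' : 0 ≤ᵐ[σ.map g] φ := by
    refine (ae_map_iff hg.aemeasurable (measurableSet_le measurable_const hφ.measurable)).2 ?_
    exact Filter.Eventually.of_forall fun w => hpos _ (hgs w)
  have := integral_mono_measure hle (hpos'.filter_mono (Measure.ae_smul_measure_le _)) (hint.smul_measure_nnreal)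
  refine this.trans (le_of_eq ?_)
  rw [integral_smul_nnreal_measure, integral_map hg.aemeasurable hφ.aestronglyMeasurable, NNReal.smul_def]
  simp [g, hr.le, mul_assoc]

abbrev sig (n : ℕ) : Measure (sphere (0 : Euc n) 1) := (volume : Measure (Euc n)).toSphere

lemma polar {m : ℕ} (G : Euc (m+1) → ℝ) (hG : Integrable G) :
    ∫ y, G y = ∫ s in Ioi (0 : ℝ), s ^ m * ∫ w, G (s • (w : Euc (m+1))) ∂(sig (m+1)) := by
  have hmp := (volume : Measure (Euc (m+1))).measurePreserving_homeomorphUnitSphereProd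
  have hdim : Module.finrank ℝ (Euc (m+1)) - 1 = m := by simp
  rw [hdim] at hmp
  have hme := (homeomorphUnitSphereProd (Euc (m+1))).measurableEmbedding
  let G' : sphere (0 : Euc (m+1)) 1 × Ioi (0:ℝ) → ℝ := fun p => G (p.2.1 • (p.1 : Euc (m+1)))
  have hG' : ∀ y : ({0}ᶜ : Set (Euc (m+1))), G' (homeomorphUnitSphereProd _ y) = G y := by
    intro y
    simp only [G']
    congr 1
    have hy : ‖(y : Euc (m+1))‖ ≠ 0 := norm_ne_zero_iff.2 y.2
    simp [smul_smul, hy]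
  have h0 : ∫ y, G y = ∫ y : ({0}ᶜ : Set (Euc (m+1))), G y ∂(Measure.comap Subtype.val volume) := by
    rw [integral_subtype_comap (measurableSet_singleton _).compl G, restrict_compl_singleton]
  have hint0 : Integrable (fun y : ({0}ᶜ : Set (Euc (m+1))) => G y) (Measure.comap Subtype.val volume) := by
    have := (integrableOn_iff_comap_subtypeVal (μ := (volume : Measure (Euc (m+1)))) (f := G)
      (measurableSet_singleton (0 : Euc (m+1))).compl).1 hG.integrableOn
    exact this
  have hint : Integrable G' ((sig (m+1)).prod (.volumeIoiPow m)) := by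
    rw [← hmp.integrable_comp_emb hme]
    exact hint0.congr (Filter.Eventually.of_forall fun y => (hG' y).symm)
  rw [h0]
  have h1 := hmp.integral_comp hme G'
  simp only [hG'] at h1
  rw [h1, integral_prod_symm _ hint]
  simp only [Measure.volumeIoiPow, ENNReal.ofReal]
  rw [integral_withDensity_eq_integral_smul,
    integral_subtype_comap measurableSet_Ioi
      fun a : ℝ ↦ Real.toNNReal (a ^ m) • ∫ w, G (a • (w : Euc (m+1))) ∂(sig (m+1)),
    setIntegral_congr_fun measurableSet_Ioi fun x hx ↦ ?_]
  · rw [NNReal.smul_def, Real.coe_toNNReal _ (pow_nonneg hx.out.le _), smul_eq_mul]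
  · exact (measurable_subtype_coe.pow_const _).real_toNNReal

lemma sph_integrable {n : ℕ} (g : sphere (0 : Euc n) 1 → ℝ) (hg : Continuous g) :
    Integrable g (sig n) :=
  hg.integrable_of_hasCompactSupport (HasCompactSupport.of_compactSpace _)

lemma f1_cont {n : ℕ} (φ : Euc n → ℝ) (hφ : ContDiff ℝ 1 φ) :
    Continuous (fun s : ℝ => ∫ w, fderiv ℝ φ (s • (w : Euc n)) (w : Euc n) ∂(sig n)) := by
  have hc : Continuous (fderiv ℝ φ) := hφ.continuous_fderiv (by norm_num)
  have := continuous_parametric_integral_of_continuous (μ := sig n)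
    (f := fun (s : ℝ) (w : sphere (0 : Euc n) 1) => fderiv ℝ φ (s • (w : Euc n)) (w : Euc n))
    (by simp only [Function.uncurry_def]; fun_prop) isCompact_univ
  simpa using this

lemma f_deriv {n : ℕ} (φ : Euc n → ℝ) (hφ : ContDiff ℝ 1 φ) (hs : HasCompactSupport φ) (s : ℝ) :
    HasDerivAt (fun s : ℝ => ∫ w, φ (s • (w : Euc n)) ∂(sig n))
      (∫ w, fderiv ℝ φ (s • (w : Euc n)) (w : Euc n) ∂(sig n)) s := by
  have hc : Continuous (fderiv ℝ φ) := hφ.continuous_fderiv (by norm_num)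
  have hφc := hφ.continuous
  obtain ⟨M, hM⟩ := hc.bounded_above_of_compact_support (hs.fderiv ℝ)
  refine (hasDerivAt_integral_of_dominated_loc_of_deriv_le (μ := sig n) (s := univ) (bound := fun _ => M)
    (F := fun (s : ℝ) (w : sphere (0 : Euc n) 1) => φ (s • (w : Euc n)))
    (F' := fun (s : ℝ) (w : sphere (0 : Euc n) 1) => fderiv ℝ φ (s • (w : Euc n)) (w : Euc n))
    Filter.univ_mem ?_ ?_ ?_ ?_ ?_ ?_).2
  · exact Filter.Eventually.of_forall fun s => (sph_integrable _ (by fun_prop)).aestronglyMeasurable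
  · exact sph_integrable _ (by fun_prop)
  · exact (sph_integrable _ (by fun_prop)).aestronglyMeasurable
  · refine Filter.Eventually.of_forall fun w t _ => ?_
    refine ((fderiv ℝ φ _).le_opNorm _).trans ?_
    simpa using hM (t • (w : Euc n))
  · exact integrable_const _
  · refine Filter.Eventually.of_forall fun w t _ => ?_
    have h1 : HasFDerivAt φ (fderiv ℝ φ (t • (w : Euc n))) (t • (w : Euc n)) :=
      (hφ.differentiable (by norm_num) _).hasFDerivAt
    have h2 : HasDerivAt (fun t : ℝ => t • (w : Euc n)) (w : Euc n) t := by
      simpa using (hasDerivAt_id t).smul_const (w : Euc n)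
    exact h1.comp_hasDerivAt t h2

lemma eta_deriv (k : ℝ → ℝ) (hk : Continuous k) (R s : ℝ) :
    HasDerivAt (fun s => ∫ t in s..R, k t) (-k s) s :=
  intervalIntegral.integral_hasDerivAt_left (hk.intervalIntegrable _ _)
    (hk.stronglyMeasurableAtFilter _ _) hk.continuousAt

lemma psi_deriv {n : ℕ} (m : ℝ → ℝ) (hm : Continuous m) (R : ℝ) (y : Euc n) :
    HasFDerivAt (fun y : Euc n => ∫ t in ‖y‖..R, t * m t) (-(m ‖y‖) • innerSL ℝ y) y := by
  have hη := eta_deriv (fun t => t * m t) (by fun_prop) R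
  by_cases hy : y = 0
  · subst hy
    have h0 := hη 0
    simp only [zero_mul, neg_zero] at h0
    have h1 := h0.isLittleO
    rw [hasFDerivAt_iff_isLittleO]
    have h2 := h1.comp_tendsto (k := fun y : Euc n => ‖y‖) (l' := 𝓝 0) (by
      simpa using (continuous_norm (E := Euc n)).tendsto 0)
    simp only [Function.comp_def] at h2
    have h4 : (fun y : Euc n => ‖y‖ - 0) =O[𝓝 0] (fun y : Euc n => y - 0) := by
      simp only [sub_zero]; exact Asymptotics.isBigO_norm_left.2 (Asymptotics.isBigO_refl _ _)
    have h3 := h2.trans_isBigO h4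
    simpa using h3
  · have h1 : HasFDerivAt (fun y : Euc n => ‖y‖) (‖y‖⁻¹ • innerSL ℝ y) y := by
      have h2 := (hasStrictFDerivAt_norm_sq y).hasFDerivAt.sqrt (by simpa using hy)
      have hny : ‖y‖ ≠ 0 := norm_ne_zero_iff.2 hy
      simp only [Real.sqrt_sq (norm_nonneg _)] at h2
      have e : ((1 / (2 * ‖y‖)) • 2 • (innerSL ℝ) y) = ‖y‖⁻¹ • innerSL ℝ y := by
        rw [← Nat.cast_smul_eq_nsmul ℝ, smul_smul]
        congr 1
        push_cast
        field_simp
      rw [e] at h2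
      exact h2
    have := (hη ‖y‖).comp_hasFDerivAt y h1
    have hny : ‖y‖ ≠ 0 := norm_ne_zero_iff.2 hy
    have e : -(‖y‖ * m ‖y‖) • ‖y‖⁻¹ • (innerSL ℝ) y = -(m ‖y‖) • innerSL ℝ y := by
      rw [smul_smul]
      congr 1
      field_simp
    rw [e] at this
    exact this

lemma lap_cont {n : ℕ} (φ : Euc n → ℝ) (hφ : ContDiff ℝ 2 φ) : Continuous (lap φ) := by
  unfold lap
  refine continuous_finsetSum _ fun i _ => ?_
  have h1 : ContDiff ℝ 1 (fun y => fderiv ℝ φ y (EuclideanSpace.single i 1)) :=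
    (hφ.fderiv_right (m := 1) (by norm_num)).clm_apply contDiff_const
  exact (h1.continuous_fderiv (by norm_num)).clm_apply continuous_const

lemma lap_supp {n : ℕ} (φ : Euc n → ℝ) (hs : HasCompactSupport φ) : HasCompactSupport (lap φ) := by
  refine hs.mono' ?_
  intro x hx
  by_contra hcon
  apply hx
  have h0 : φ =ᶠ[𝓝 x] 0 := notMem_tsupport_iff_eventuallyEq.1 hcon
  unfold lap
  refine Finset.sum_eq_zero fun i _ => ?_
  have h1 : (fun y => fderiv ℝ φ y (EuclideanSpace.single i 1)) =ᶠ[𝓝 x] fun _ => 0 := by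
    filter_upwards [h0.fderiv (𝕜 := ℝ)] with y hy
    rw [hy]; simp
  rw [h1.fderiv_eq]; simp

lemma weak {n : ℕ} (φ : Euc n → ℝ) (hφ : ContDiff ℝ 2 φ) (hs : HasCompactSupport φ)
    (m : ℝ → ℝ) (hm : Continuous m) (R : ℝ) :
    ∫ y, (∫ t in ‖y‖..R, t * m t) * lap φ y = ∫ y, m ‖y‖ * fderiv ℝ φ y y := by
  set ψ : Euc n → ℝ := fun y => ∫ t in ‖y‖..R, t * m t with hψ
  have hψd : ∀ y, HasFDerivAt ψ (-(m ‖y‖) • innerSL ℝ y) y := psi_deriv m hm R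
  have hψc : Continuous ψ := continuous_iff_continuousAt.2 fun y => (hψd y).continuousAt
  have hφc : Continuous (fderiv ℝ φ) := hφ.continuous_fderiv (by norm_num)
  have hg : ∀ i, ContDiff ℝ 1 (fun y => fderiv ℝ φ y (EuclideanSpace.single i 1)) := fun i =>
    (hφ.fderiv_right (m := 1) (by norm_num)).clm_apply contDiff_const
  have hgs : ∀ i : Fin n, HasCompactSupport (fun y => fderiv ℝ φ y (EuclideanSpace.single i 1)) := fun i =>
    (hs.fderiv ℝ).comp_left (g := fun L : Euc n →L[ℝ] ℝ => L (EuclideanSpace.single i 1)) (by simp)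
  have hgd : ∀ i : Fin n, Continuous fun y => fderiv ℝ (fun y => fderiv ℝ φ y (EuclideanSpace.single i 1)) y
    (EuclideanSpace.single i 1) := fun i => 
    ((hg i).continuous_fderiv (by norm_num)).clm_apply continuous_const
  have hgds : ∀ i : Fin n, HasCompactSupport fun y => fderiv ℝ (fun y => fderiv ℝ φ y (EuclideanSpace.single i 1)) y
    (EuclideanSpace.single i 1) := fun i => 
    ((hgs i).fderiv ℝ).comp_left (g := fun L : Euc n →L[ℝ] ℝ => L (EuclideanSpace.single i 1)) (by simp)
  have hψf : ∀ (i : Fin n) y, fderiv ℝ ψ y (EuclideanSpace.single i 1) = -(m ‖y‖ * y i) := by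
    intro i y
    rw [(hψd y).fderiv]
    have := EuclideanSpace.inner_single_right (𝕜 := ℝ) i 1 y
    simp only [_root_.smul_apply, innerSL_apply_apply, smul_eq_mul]
    rw [this]; simp
  have hi1 : ∀ i : Fin n, Integrable fun y => ψ y * fderiv ℝ (fun y => fderiv ℝ φ y (EuclideanSpace.single i 1)) y
    (EuclideanSpace.single i 1) := fun i =>
    (hψc.mul (hgd i)).integrable_of_hasCompactSupport (hgds i).mul_left
  have hi2 : ∀ i : Fin n, Integrable fun y => fderiv ℝ ψ y (EuclideanSpace.single i 1) * 
      fderiv ℝ φ y (EuclideanSpace.single i 1) := fun i => by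
    simp only [hψf]
    exact Continuous.integrable_of_hasCompactSupport (by fun_prop) (hgs i).mul_left
  have hi3 : ∀ i : Fin n, Integrable fun y => ψ y * 
      fderiv ℝ φ y (EuclideanSpace.single i 1) := fun i => by
    exact Continuous.integrable_of_hasCompactSupport (by fun_prop) (hgs i).mul_left
  have hibp : ∀ i : Fin n, _ := fun i => integral_mul_fderiv_eq_neg_fderiv_mul_of_integrable
    (hi2 i) (hi1 i) (hi3 i) (fun y _ => (hψd y).differentiableAt)
    (fun y _ => (hg i).differentiable (by norm_num) y)
  unfold lap
  simp only [Finset.mul_sum]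
  rw [integral_finsetSum _ (fun i _ => hi1 i)]
  rw [Finset.sum_congr rfl fun i _ => hibp i, Finset.sum_neg_distrib, ← integral_finsetSum _ (fun i _ => hi2 i),
    ← integral_neg]
  congr 1
  ext y
  have hy : y = ∑ i, y i • EuclideanSpace.single i (1 : ℝ) := by
    ext j; simp [Finset.sum_apply, Pi.single_apply]
  simp only [hψf]
  conv_rhs => rw [show fderiv ℝ φ y y = fderiv ℝ φ y (∑ i, y i • EuclideanSpace.single i (1 : ℝ)) by rw [← hy]]
  rw [map_sum, Finset.mul_sum, ← Finset.sum_neg_distrib]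
  refine Finset.sum_congr rfl fun i _ => ?_
  simp only [map_smul, smul_eq_mul]; ring

lemma D_meas {n : ℕ} (L : Euc n → ℝ) (hL : Continuous L) :
    StronglyMeasurable (fun s : ℝ => ∫ y in ball (0 : Euc n) s, L y) := by
  have : (fun s : ℝ => ∫ y in ball (0 : Euc n) s, L y) = 
      fun s => ∫ y, ({p : ℝ × Euc n | ‖p.2‖ < p.1}.indicator (fun p => L p.2)) (s, y) := by
    ext s
    rw [← integral_indicator measurableSet_ball]
    congr 1; ext y
    simp [indicator]
  rw [this]
  refine StronglyMeasurable.integral_prod_right' (f := ({p : ℝ × Euc n | ‖p.2‖ < p.1}.indicator (fun p => L p.2))) ?_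
  refine StronglyMeasurable.indicator ?_ (isOpen_lt (by fun_prop) (by fun_prop)).measurableSet
  exact (hL.comp continuous_snd).stronglyMeasurable

lemma D_bound {n : ℕ} (L : Euc n → ℝ) (hL : Integrable L) (s : ℝ) :
    ‖∫ y in ball (0 : Euc n) s, L y‖ ≤ ∫ y, ‖L y‖ :=
  (norm_integral_le_integral_norm _).trans
    (setIntegral_le_integral hL.norm (Filter.Eventually.of_forall fun _ => norm_nonneg _))

lemma fub {n : ℕ} (L : Euc n → ℝ) (hL : Continuous L) (hLs : HasCompactSupport L)
    (k : ℝ → ℝ) (hk : Continuous k) (R : ℝ) (hR : 0 ≤ R) (hkR : ∀ t, R ≤ t → k t = 0) :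
    ∫ y, (∫ t in ‖y‖..R, k t) * L y = ∫ s in Ioi (0 : ℝ), k s * ∫ y in ball (0 : Euc n) s, L y := by
  have hLi : Integrable L := hL.integrable_of_hasCompactSupport hLs
  have hki : IntegrableOn k (Ioi 0) := by
    have : IntegrableOn k (Ioc 0 R ∪ Ioi R) := by
      refine IntegrableOn.union ((hk.intervalIntegrable 0 R).1) ?_
      exact integrableOn_zero.congr_fun (fun t ht => (hkR t (le_of_lt ht)).symm) measurableSet_Ioi
    rwa [Ioc_union_Ioi_eq_Ioi hR] at this
  let S : Set (Euc n × ℝ) := {p | ‖p.1‖ < p.2}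
  have hS : MeasurableSet S := (isOpen_lt (by fun_prop) (by fun_prop)).measurableSet
  have hF : Integrable (S.indicator fun p => L p.1 * k p.2) 
      ((volume : Measure (Euc n)).prod (volume.restrict (Ioi (0:ℝ)))) :=
    (hLi.mul_prod hki).indicator hS
  have hsw := integral_integral_swap (f := fun y s => S.indicator (fun p => L p.1 * k p.2) (y, s)) hF
  convert hsw using 1
  · congr 1; ext y
    have e1 : (∫ t in ‖y‖..R, k t) = ∫ t in Ioi ‖y‖, k t := by
      have hz : ∫ t in Ioi R, k t = 0 :=
        setIntegral_eq_zero_of_forall_eq_zero fun t ht => hkR t (le_of_lt ht)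
      have := intervalIntegral.integral_interval_add_Ioi (f := k) (a := ‖y‖) (b := R) (μ := volume)
        (hki.mono_set (Ioi_subset_Ioi (norm_nonneg y))) (hki.mono_set (Ioi_subset_Ioi hR))
      rw [hz, add_zero] at this
      exact this
    rw [e1]
    have e2 : ∀ s, S.indicator (fun p => L p.1 * k p.2) (y, s) = (Ioi ‖y‖).indicator (fun s => L y * k s) s := by
      intro s; simp [S, indicator]
    simp only [e2]
    rw [setIntegral_indicator measurableSet_Ioi, inter_eq_right.2 (Ioi_subset_Ioi (norm_nonneg y)),
      integral_const_mul, mul_comm]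
  · congr 1; ext s
    have e2 : ∀ y, S.indicator (fun p => L p.1 * k p.2) (y, s) = (ball (0 : Euc n) s).indicator (fun y => k s * L y) y := by
      intro y; simp [S, indicator, mul_comm]
    simp only [e2]
    rw [integral_indicator measurableSet_ball, integral_const_mul]

lemma key {m : ℕ} (φ : Euc (m+1) → ℝ) (hφ : ContDiff ℝ 2 φ) (hs : HasCompactSupport φ) :
    ∀ᵐ s : ℝ, s ∈ Ioi (0 : ℝ) → (∫ w, fderiv ℝ φ (s • (w : Euc (m+1))) (w : Euc (m+1)) ∂(sig (m+1)))
      * s ^ m = ∫ y in ball (0 : Euc (m+1)) s, lap φ y := by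
  have hLc := lap_cont φ hφ
  have hLs := lap_supp φ hs
  have hLi : Integrable (lap φ) := hLc.integrable_of_hasCompactSupport hLs
  have hφ1 : ContDiff ℝ 1 φ := hφ.of_le (by norm_num)
  have hdc : Continuous (fderiv ℝ φ) := hφ.continuous_fderiv (by norm_num)
  set f1 : ℝ → ℝ := fun s => ∫ w, fderiv ℝ φ (s • (w : Euc (m+1))) (w : Euc (m+1)) ∂(sig (m+1)) with hf1
  have hf1c : Continuous f1 := f1_cont φ hφ1
  set D : ℝ → ℝ := fun s => ∫ y in ball (0 : Euc (m+1)) s, lap φ y with hD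
  have hDli : LocallyIntegrable D volume := by
    refine (locallyIntegrable_const (∫ y, ‖lap φ y‖)).mono (D_meas _ hLc).aestronglyMeasurable ?_
    refine Filter.Eventually.of_forall fun s => (D_bound _ hLi s).trans (le_abs_self _)
  have hli : LocallyIntegrable (fun s => s * (f1 s * s ^ m - D s)) volume := by
    have h1 : LocallyIntegrable (fun s => s * (f1 s * s ^ m)) volume := Continuous.locallyIntegrable (by fun_prop)
    have h2 : LocallyIntegrable (fun s => s * D s) volume := by
      have := (locallyIntegrableOn_univ.2 hDli).continuousOn_mul (g := fun s : ℝ => s) continuousOn_id isOpen_univ.isLocallyClosed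
      exact locallyIntegrableOn_univ.1 this
    have := h1.sub h2
    refine this.congr ?_
    exact Filter.Eventually.of_forall fun s => by simp; ring
  have hz := isOpen_Ioi.ae_eq_zero_of_integral_contDiff_smul_eq_zero (U := Ioi (0:ℝ))
    (f := fun s => s * (f1 s * s ^ m - D s)) (μ := volume) (hli.locallyIntegrableOn _) ?_
  · filter_upwards [hz] with s hs hs0
    have := hs hs0
    have hs0' : s ≠ 0 := ne_of_gt hs0
    have := (mul_eq_zero.1 this).resolve_left hs0'
    exact sub_eq_zero.1 this
  intro g hg hgs hgU
  have hgc := hg.continuous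
  obtain ⟨R, hR⟩ := hgs.isCompact.isBounded.subset_closedBall 0
  have hgR : ∀ t, max R 0 + 1 ≤ t → g t = 0 := by
    intro t ht
    by_contra h
    have := hR (subset_tsupport _ h)
    rw [mem_closedBall_zero_iff, Real.norm_eq_abs] at this
    have := le_abs_self t
    have := le_max_left R 0
    linarith
  have hg0 : ∀ t, t ∉ Ioi (0:ℝ) → g t = 0 := by
    intro t ht
    by_contra h
    exact ht (hgU (subset_tsupport _ h))
  have hA := weak φ hφ hs g hgc (max R 0 + 1)
  have hB := fub (lap φ) hLc hLs (fun t => t * g t) (by fun_prop) (max R 0 + 1) (by positivity)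
    (fun t ht => by simp [hgR t ht])
  have hC := polar (fun y : Euc (m+1) => g ‖y‖ * fderiv ℝ φ y y) (Continuous.integrable_of_hasCompactSupport (by fun_prop) (by
    have : HasCompactSupport (fun y : Euc (m+1) => fderiv ℝ φ y y) := by
      refine (hs.fderiv ℝ).mono ?_
      intro y hy h0
      exact hy (by simp [h0])
    exact this.mul_left))
  rw [hB, hC] at hA
  have hsub : ∫ x, g x • (x * (f1 x * x ^ m - D x)) = 
     ∫ x in Ioi (0:ℝ), g x • (x * (f1 x * x ^ m - D x)) := by
    refine (setIntegral_eq_integral_of_forall_compl_eq_zero fun x hx => ?_).symm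
    simp [hg0 x hx]
  rw [hsub]
  have i1 : IntegrableOn (fun x => x * g x * D x) (Ioi 0) := by
    have : Integrable (fun x => (x * g x) * D x) := by
      refine Integrable.mul_bdd (c := ∫ y, ‖lap φ y‖) ?_ (D_meas _ hLc).aestronglyMeasurable ?_
      · exact Continuous.integrable_of_hasCompactSupport (by fun_prop) hgs.mul_left
      · exact Filter.Eventually.of_forall fun s => D_bound _ hLi s
    exact this.integrableOn
  have i2 : IntegrableOn (fun x => x ^ m * (g x * (x * f1 x))) (Ioi 0) := by
    refine Integrable.integrableOn ?_
    exact Continuous.integrable_of_hasCompactSupport (by fun_prop) (hgs.mul_right).mul_left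
  have e : ∀ x ∈ Ioi (0:ℝ), x ^ m * ∫ w, (fun y : Euc (m+1) => g ‖y‖ * fderiv ℝ φ y y) (x • (w : Euc (m+1))) ∂(sig (m+1))
     = x ^ m * (g x * (x * f1 x)) := by
    intro x hx
    have hx' : (0:ℝ) < x := hx
    congr 1
    simp only [norm_smul, Real.norm_eq_abs, abs_of_pos hx', norm_eq_of_mem_sphere, mul_one, map_smul, smul_eq_mul]
    rw [integral_const_mul, integral_const_mul]
  rw [setIntegral_congr_fun measurableSet_Ioi e] at hA
  have : ∀ x, g x • (x * (f1 x * x ^ m - D x)) = x ^ m * (g x * (x * f1 x)) - x * g x * D x := by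
    intro x; simp only [smul_eq_mul]; ring
  simp only [this]
  rw [integral_sub i2 i1, ← hA]
  simp [hD]

lemma main0 {m : ℕ} (φ : Euc (m+1) → ℝ) (hφ : ContDiff ℝ 2 φ) (hs : HasCompactSupport φ) (r : ℝ)
    (hr : 0 < r) :
    ∫ w, φ (r • (w : Euc (m+1))) ∂(sig (m+1)) ≤ (sig (m+1)).real univ * φ 0 +
      ∫ s in Ioo (0 : ℝ) r, s ^ (-(m : ℝ)) * ∫ y in ball (0 : Euc (m+1)) s, |lap φ y| := by
  have hφ1 : ContDiff ℝ 1 φ := hφ.of_le (by norm_num)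
  have hLc := lap_cont φ hφ
  have hLs := lap_supp φ hs
  have hLi : Integrable (lap φ) := hLc.integrable_of_hasCompactSupport hLs
  have hc := f1_cont φ hφ1
  have hftc := intervalIntegral.integral_eq_sub_of_hasDerivAt (a := 0) (b := r)
    (fun s _ => f_deriv φ hφ1 hs s) (hc.intervalIntegrable _ _)
  simp only [zero_smul, integral_const, smul_eq_mul] at hftc
  rw [intervalIntegral.integral_of_le hr.le, integral_Ioc_eq_integral_Ioo] at hftc
  obtain ⟨M, hM⟩ := hLc.bounded_above_of_compact_support hLs
  have hM0 : 0 ≤ M := (norm_nonneg _).trans (hM 0)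
  set A : ℝ → ℝ := fun s => ∫ y in ball (0 : Euc (m+1)) s, |lap φ y| with hA
  have hA0 : ∀ s, 0 ≤ A s := fun s => integral_nonneg fun _ => abs_nonneg _
  set c := (volume : Measure (Euc (m+1))).real (ball 0 1) with hcdef
  have hAb : ∀ s ∈ Ioo (0 : ℝ) r, A s ≤ M * (s ^ (m+1) * c) := by
    intro s hs
    have h1 := norm_setIntegral_le_of_norm_le_const (μ := (volume : Measure (Euc (m+1))))
      (s := ball 0 s) (f := fun y => |lap φ y|) (C := M) measure_ball_lt_top
      (fun y _ => by simpa using hM y)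
    have h2 : (volume : Measure (Euc (m+1))).real (ball 0 s) = s ^ (m+1) * c := by
      have := Measure.addHaar_ball (volume : Measure (Euc (m+1))) 0 hs.1.le
      rw [hcdef, measureReal_def, measureReal_def, this, ENNReal.toReal_mul,
        ENNReal.toReal_ofReal (pow_nonneg hs.1.le _)]
      simp
    rw [h2] at h1
    exact (le_abs_self _).trans h1
  have hint : IntegrableOn (fun s => s ^ (-(m : ℝ)) * A s) (Ioo 0 r) := by
    refine Measure.integrableOn_of_bounded (M := M * c * r) measure_Ioo_lt_top.ne ?_ ?_
    · refine AEStronglyMeasurable.mul ?_ (D_meas _ hLc.abs).aestronglyMeasurable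
      exact (measurable_id.pow_const _).aestronglyMeasurable
    · filter_upwards [ae_restrict_mem measurableSet_Ioo] with s hs
      have hs0 := hs.1
      have hp : 0 ≤ s ^ (-(m : ℝ)) := Real.rpow_nonneg hs0.le _
      rw [Real.norm_eq_abs, abs_of_nonneg (mul_nonneg hp (hA0 s))]
      calc _ ≤ s ^ (-(m : ℝ)) * (M * (s ^ (m+1) * c)) := by gcongr; exact hAb s hs
        _ = M * c * s := by
          rw [Real.rpow_neg hs0.le, Real.rpow_natCast, pow_succ]
          field_simp
        _ ≤ _ := by
          have := hs.2.le
          gcongr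
  have hle : ∫ s in Ioo (0:ℝ) r, (∫ w, fderiv ℝ φ (s • (w : Euc (m+1))) (w : Euc (m+1)) ∂(sig (m+1))) ≤
      ∫ s in Ioo (0 : ℝ) r, s ^ (-(m : ℝ)) * A s := by
    refine integral_mono_ae ?_ hint ?_
    · exact (hc.integrableOn_Icc (a := 0) (b := r)).mono_set Ioo_subset_Icc_self
    · filter_upwards [ae_restrict_mem measurableSet_Ioo, ae_restrict_of_ae (key φ hφ hs)] with s hs hk
      have hs0 := hs.1
      have h1 := hk hs0
      have h2 : ∫ y in ball (0 : Euc (m+1)) s, lap φ y ≤ A s :=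
        integral_mono hLi.integrableOn hLi.abs.integrableOn fun y => le_abs_self _
      rw [← h1] at h2
      rw [Real.rpow_neg hs0.le, Real.rpow_natCast, ← div_eq_inv_mul, le_div_iff₀ (by positivity)]
      exact h2
  linarith

theorem mean_value_aux (m : ℕ) :
    ∃ C : ℝ, 0 < C ∧
      ∀ (x : Euc (m+1)) (r : ℝ), 0 < r →
        ∀ φ : Euc (m+1) → ℝ, (∀ y ∈ closedBall x r, 0 ≤ φ y) →
          (∃ U : Set (Euc (m+1)), IsOpen U ∧ closedBall x r ⊆ U ∧ ContDiffOn ℝ (⊤ : ℕ∞) φ U) →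
          (1 / r ^ m) * (∫ y in sphere x r, φ y ∂(μH[(m : ℝ)])) ≤
            C * (φ x +
              ∫ s in Ioo (0 : ℝ) r, s ^ (-(m : ℝ)) * ∫ y in ball x s, |lap φ y|) := by
  obtain ⟨K, hK, hH⟩ := haus_sphere m
  refine ⟨K * ((sig (m+1)).real univ + 1), by positivity, ?_⟩
  rintro x r hr φ hpos ⟨U, hU, hxU, hφ⟩
  -- cutoff
  obtain ⟨δ, hδ, hδU⟩ := (isCompact_closedBall x r).exists_cthickening_subset_open hU hxU
  have hδU' : closedBall x (r + δ) ⊆ U := by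
    rw [cthickening_closedBall hδ.le hr.le, add_comm δ r] at hδU
    exact hδU
  let χ : ContDiffBump x := ⟨r, r + δ, hr, by linarith⟩
  let g : Euc (m+1) → ℝ := fun y => χ y * φ y
  have hgeq : ∀ y ∈ closedBall x r, g y = φ y := by
    intro y hy
    simp only [g]
    rw [χ.one_of_mem_closedBall hy, one_mul]
  have hgs : HasCompactSupport g := χ.hasCompactSupport.mul_right
  have hgd : ContDiff ℝ 2 g := by
    rw [contDiff_iff_contDiffAt]
    intro y
    by_cases hy : y ∈ closedBall x (r + δ)
    · have h1 : ContDiffAt ℝ (⊤ : ℕ∞) φ y := hφ.contDiffAt (hU.mem_nhds (hδU' hy))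
      exact (χ.contDiffAt (n := 2)).mul (h1.of_le (by exact_mod_cast le_top))
    · have : g =ᶠ[𝓝 y] fun _ => 0 := by
        filter_upwards [isClosed_closedBall.isOpen_compl.mem_nhds hy] with z hz
        have hz' : r + δ ≤ dist z x := by
          by_contra hcon
          exact hz (mem_closedBall.2 (not_le.1 hcon).le)
        simp only [g]
        rw [χ.zero_of_le_dist hz', zero_mul]
      exact contDiffAt_const.congr_of_eventuallyEq this
  have hlap : ∀ y ∈ ball x r, lap g y = lap φ y := by
    intro y hy
    have he : g =ᶠ[𝓝 y] φ := by
      filter_upwards [isOpen_ball.mem_nhds hy] with z hz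
      exact hgeq z (ball_subset_closedBall hz)
    unfold lap
    refine Finset.sum_congr rfl fun i _ => ?_
    have h1 : (fun y => fderiv ℝ g y (EuclideanSpace.single i 1)) =ᶠ[𝓝 y]
        fun y => fderiv ℝ φ y (EuclideanSpace.single i 1) := by
      filter_upwards [he.fderiv (𝕜 := ℝ)] with z hz
      rw [hz]
    rw [h1.fderiv_eq]
  let h : Euc (m+1) → ℝ := fun y => g (x + y)
  have hhd : ContDiff ℝ 2 h := hgd.comp (contDiff_const.add contDiff_id)
  have hhs : HasCompactSupport h := hgs.comp_homeomorph (Homeomorph.addLeft x)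
  have hhl : ∀ y, lap h y = lap g (x + y) := by
    intro y
    simp only [lap, h, fderiv_comp_add_left]
    refine Finset.sum_congr rfl fun i _ => ?_
    rw [fderiv_comp_add_left (f := fun z => fderiv ℝ g z (EuclideanSpace.single i 1))]
  have hm := main0 h hhd hhs r hr
  have hI : ∫ s in Ioo (0 : ℝ) r, s ^ (-(m : ℝ)) * ∫ y in ball (0 : Euc (m+1)) s, |lap h y| =
      ∫ s in Ioo (0 : ℝ) r, s ^ (-(m : ℝ)) * ∫ y in ball x s, |lap φ y| := by
    refine setIntegral_congr_fun measurableSet_Ioo fun s hs => ?_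
    congr 1
    have e1 : ∫ y in ball x s, |lap φ y| = ∫ y in ball x s, |lap g y| :=
      setIntegral_congr_fun measurableSet_ball fun y hy => by
        show |lap φ y| = |lap g y|
        rw [hlap y (ball_subset_ball hs.2.le hy)]
    rw [e1]
    simp only [hhl]
    rw [← integral_indicator measurableSet_ball, ← integral_indicator measurableSet_ball]
    rw [← integral_add_left_eq_self ((ball x s).indicator fun y => |lap g y|) x]
    congr 1
    ext y
    simp [indicator]
  rw [hI] at hm
  have hsph := hH x r hr g hgd.continuous (fun y hy => by
    rw [hgeq y (sphere_subset_closedBall hy)]; exact hpos y (sphere_subset_closedBall hy))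
  have hse : ∫ y in sphere x r, φ y ∂(μH[(m : ℝ)]) = ∫ y in sphere x r, g y ∂(μH[(m : ℝ)]) :=
    setIntegral_congr_fun isClosed_sphere.measurableSet
      fun y hy => (hgeq y (sphere_subset_closedBall hy)).symm
  rw [hse]
  have hx : x ∈ closedBall x r := mem_closedBall_self hr.le
  have hh0 : h 0 = φ x := by simp only [h, add_zero]; exact hgeq x hx
  rw [hh0] at hm
  set I := ∫ s in Ioo (0 : ℝ) r, s ^ (-(m : ℝ)) * ∫ y in ball x s, |lap φ y| with hIdef
  have hI0 : 0 ≤ I := by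
    refine setIntegral_nonneg measurableSet_Ioo fun s hs => ?_
    exact mul_nonneg (Real.rpow_nonneg hs.1.le _) (integral_nonneg fun _ => abs_nonneg _)
  have hφx := hpos x hx
  have hσ : 0 ≤ (sig (m+1)).real univ := measureReal_nonneg
  have hrm : 0 < r ^ m := by positivity
  calc _ ≤ (1 / r ^ m) * (r ^ m * (K * ∫ w, g (x + r • (w : Euc (m+1))) ∂(sig (m+1)))) := by
        gcongr
    _ = K * ∫ w, g (x + r • (w : Euc (m+1))) ∂(sig (m+1)) := by
        rw [← mul_assoc, one_div_mul_cancel hrm.ne', one_mul]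
    _ ≤ K * ((sig (m+1)).real univ * φ x + I) := by gcongr
    _ ≤ _ := by
        rw [mul_assoc]
        gcongr
        nlinarith [mul_nonneg hσ hI0]

/-- **Mean value-type inequality controlled by the mass of the Laplacian.** For `n ≥ 3`
there is `C(n)` such that for every `x`, `r > 0` and every nonnegative function `φ`
smooth on a neighborhood of the closed ball `closedBall x r`,
`(1/r^{n−1}) ∫_{∂B_r(x)} φ dℋ^{n−1} ≤ C(n)·( φ(x) + ∫₀^r s^{1−n} (∫_{B_s(x)} |Δφ|) ds )`. -/
theorem mean_value_inequality (n : ℕ) (hn : 3 ≤ n) :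
    ∃ C : ℝ, 0 < C ∧
      ∀ (x : Euc n) (r : ℝ), 0 < r →
        ∀ φ : Euc n → ℝ, (∀ y ∈ closedBall x r, 0 ≤ φ y) →
          (∃ U : Set (Euc n), IsOpen U ∧ closedBall x r ⊆ U ∧ ContDiffOn ℝ (⊤ : ℕ∞) φ U) →
          (1 / r ^ (n - 1)) * (∫ y in sphere x r, φ y ∂(μH[(n : ℝ) - 1])) ≤
            C * (φ x +
              ∫ s in Ioo (0 : ℝ) r, s ^ ((1 : ℝ) - n) * ∫ y in ball x s, |lap φ y|) := by
  obtain ⟨m, rfl⟩ : ∃ m, n = m + 1 := ⟨n - 1, by omega⟩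
  have h := mean_value_aux m
  have e1 : ((m + 1 : ℕ) : ℝ) - 1 = m := by push_cast; ring
  have e2 : (1 : ℝ) - ((m + 1 : ℕ) : ℝ) = -(m : ℝ) := by push_cast; ring
  rw [e1, e2, Nat.add_sub_cancel]
  exact h
end
end
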